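/- Smoothness of the pairwise partial covariance (Theorem 3.7, bounds (3.10) and (3.11)). Fix K < ∞, κ > 3, 0 < λ_inf ≤ λ_sup < ∞ and N₀ ∈ ℕ. There exists a constant 𝒦 < ∞, depending only on K, κ, λ_inf, λ_sup, such that whenever Assumption LS(p, K, κ, λ_inf, λ_sup, N₀) holds with p ≥ 3, for all distinct a, b ∈ {1, …, p}, all N ≥ N₀, all t, τ ∈ ℤ and all u, v ∈ ℝ: ‖Δ^{−{a,b}}_{t,τ,N} − Δ^{−{a,b}}_{t−τ}(t/N)‖₂ ≤ 𝒦 ζ(t−τ)^{κ−2} min(1/N, ζ(t−τ)) and ‖Δ^{−{a,b}}_{t−τ}(u) − Δ^{−{a,b}}_{t−τ}(v)‖₂ ≤ 𝒦 |u−v| ζ(t−τ)^{κ−1}. -/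

import Mathlib

noncomputable section

/-- `⟨x⟩ = max(1,|x|)` -/
def gu (x : ℝ) : ℝ := max 1 |x|

/-- `ζ(x) = max(1, log⟨x⟩)/⟨x⟩` -/
def zeta (x : ℝ) : ℝ := max 1 (Real.log (gu x)) / gu x

/-- spectral norm of a matrix -/
def specNorm {𝕜 : Type*} [RCLike 𝕜] {m n : Type*} [Fintype m] [Fintype n] [DecidableEq n]
    (M : Matrix m n 𝕜) : ℝ :=
  ‖LinearMap.toContinuousLinearMap (Matrix.toEuclideanLin M)‖

/-- `ℓ²(ι; ℝ^p)` -/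
abbrev HpI (ι : Type) (p : ℕ) : Type := lp (fun _ : ι => EuclideanSpace ℝ (Fin p)) 2

abbrev Hp (p : ℕ) : Type := HpI ℤ p

/-- the sequence `δ_t ⊗ e_a` -/
def bvec {ι : Type} [DecidableEq ι] (p : ℕ) (t : ι) (a : Fin p) : HpI ι p :=
  lp.single 2 t (EuclideanSpace.single a 1)

/-- the `p × p` block `A_{t,τ}` of an operator -/
def blk {ι : Type} [DecidableEq ι] {p : ℕ} (A : HpI ι p →L[ℝ] HpI ι p) (t τ : ι) :
    Matrix (Fin p) (Fin p) ℝ :=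
  Matrix.of fun a b => inner (𝕜 := ℝ) (bvec p t a) (A (bvec p τ b))


/-- Assumption LS(p, K, κ, λ_inf, λ_sup, N₀): a locally stationary family of covariance
operators `𝐂^(N)` together with the smooth local autocovariance functions `C_r(·)`. -/
structure AssumptionLS (p : ℕ) (K κ lamInf lamSup : ℝ) (N₀ : ℕ)
    (C : ℕ → Hp p →L[ℝ] Hp p) (Cr : ℤ → ℝ → Matrix (Fin p) (Fin p) ℝ) : Prop where
  symm : ∀ (N : ℕ) (x y : Hp p), inner (𝕜 := ℝ) ((C N) x) y = inner (𝕜 := ℝ) x ((C N) y)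
  lower : ∀ N : ℕ, N₀ ≤ N → ∀ v : Hp p, lamInf * ‖v‖ ^ 2 ≤ inner (𝕜 := ℝ) v ((C N) v)
  upper : ∀ N : ℕ, N₀ ≤ N → ∀ v : Hp p, inner (𝕜 := ℝ) v ((C N) v) ≤ lamSup * ‖v‖ ^ 2
  decay : ∀ N : ℕ, 1 ≤ N → ∀ t τ : ℤ,
    specNorm (blk (C N) t τ) ≤ K * gu ((t : ℝ) - (τ : ℝ)) ^ (-κ)
  crSymm : ∀ (r : ℤ) (u : ℝ), Cr r u = (Cr (-r) u).transpose
  crBound : ∀ (r : ℤ) (u : ℝ), specNorm (Cr r u) ≤ K * gu (r : ℝ) ^ (-κ)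
  crLip : ∀ (r : ℤ) (u v : ℝ),
    specNorm (Cr r u - Cr r v) ≤ K * |u - v| * gu (r : ℝ) ^ (-κ)
  approx : ∀ N : ℕ, 1 ≤ N → ∀ t τ : ℤ,
    specNorm (blk (C N) t τ - Cr (t - τ) ((t : ℝ) / (N : ℝ))) ≤
      K * gu ((t : ℝ) - (τ : ℝ)) ^ (-κ + 1) *
        min (1 / (N : ℝ)) (2 / gu ((t : ℝ) - (τ : ℝ)))

/-- `ℓ²(ℤ; ℝ^α)` for a finite index set `α` of components -/
abbrev HE (α : Type) [Fintype α] : Type := lp (fun _ : ℤ => EuclideanSpace ℝ α) 2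

/-- the sequence `δ_t ⊗ e_i` in `ℓ²(ℤ; ℝ^α)` -/
def bvE {α : Type} [Fintype α] [DecidableEq α] (t : ℤ) (i : α) : HE α :=
  lp.single 2 t (EuclideanSpace.single i 1)

/-- the scalar entry of an operator between component-restricted sequence spaces -/
def entE {α β : Type} [Fintype α] [DecidableEq α] [Fintype β] [DecidableEq β]
    (B : HE β →L[ℝ] HE α) (t τ : ℤ) (i : α) (j : β) : ℝ :=
  inner (𝕜 := ℝ) (bvE t i) (B (bvE τ j))

/-- the `(t,τ)` block of the Schur complement `𝐂_{S,S} − 𝐂_{S,S′} 𝐄 (𝐂_{S,S′})^*`,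
as a `2 × 2` matrix (here `S` is a two-element component set indexed by `Fin 2`) -/
def schurBlock {β : Type} [Fintype β] [DecidableEq β]
    (CSS : HE (Fin 2) →L[ℝ] HE (Fin 2)) (CSSp : HE β →L[ℝ] HE (Fin 2))
    (E : HE β →L[ℝ] HE β) (t τ : ℤ) : Matrix (Fin 2) (Fin 2) ℝ :=
  Matrix.of fun i j =>
    inner (𝕜 := ℝ) (bvE t i)
      ((CSS - CSSp.comp (E.comp (ContinuousLinearMap.adjoint CSSp))) (bvE τ j))

theorem one_le_gu (x : ℝ) : 1 ≤ gu x := le_max_left _ _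

theorem gu_pos (x : ℝ) : 0 < gu x := zero_lt_one.trans_le (one_le_gu x)

theorem abs_le_gu (x : ℝ) : |x| ≤ gu x := le_max_right _ _

theorem gu_neg (x : ℝ) : gu (-x) = gu x := by simp [gu]

theorem gu_sub_comm (x y : ℝ) : gu (x - y) = gu (y - x) := by
  rw [← gu_neg, neg_sub]

theorem gu_zero : gu 0 = 1 := by simp [gu]

theorem gu_rpow_pos (x α : ℝ) : 0 < gu x ^ α := Real.rpow_pos_of_pos (gu_pos x) α

theorem gu_sub_le_two_mul_max (x y z : ℝ) : gu (x - z) ≤ 2 * max (gu (x - y)) (gu (y - z)) := by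
  have h1 := abs_sub_le x y z
  have h2 := abs_le_gu (x - y)
  have h3 := abs_le_gu (y - z)
  have h4 := one_le_gu (x - y)
  have h5 := le_max_left (gu (x - y)) (gu (y - z))
  have h6 := le_max_right (gu (x - y)) (gu (y - z))
  exact max_le (by linarith) (by linarith)

theorem abs_gu_sub_gu_le (x y z : ℝ) : |gu (x - z) - gu (y - z)| ≤ gu (x - y) := by
  refine ((abs_max_sub_max_le_max 1 |x - z| 1 |y - z|).trans
    (max_le (by simp) ?_)).trans (abs_le_gu _)
  simpa using abs_abs_sub_abs_le_abs_sub (x - z) (y - z)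

theorem gu_rpow_neg_le_zeta_rpow (x : ℝ) {α : ℝ} (hα : 0 ≤ α) : gu x ^ (-α) ≤ zeta x ^ α := by
  rw [Real.rpow_neg (gu_pos x).le, ← Real.inv_rpow (gu_pos x).le]
  refine Real.rpow_le_rpow (inv_nonneg.2 (gu_pos x).le) ?_ hα
  rw [zeta, inv_eq_one_div]
  exact div_le_div_of_nonneg_right (le_max_left _ _) (gu_pos x).le

theorem zeta_pos (x : ℝ) : 0 < zeta x :=
  div_pos (zero_lt_one.trans_le (le_max_left _ _)) (gu_pos x)

theorem summable_gu_rpow_neg {α : ℝ} (hα : 1 < α) :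
    Summable fun k : ℤ => gu (k : ℝ) ^ (-α) := by
  have h := Real.summable_abs_int_rpow hα
  refine (h.add (summable_of_hasFiniteSupport
    (f := fun k : ℤ => if k = 0 then (1 : ℝ) else 0) ?_)).of_nonneg_of_le
    (fun k => (gu_rpow_pos _ _).le) fun k => ?_
  · exact (Set.finite_singleton (0 : ℤ)).subset fun k hk => by
      by_contra h
      exact hk (if_neg h)
  · by_cases hk : k = 0
    · subst hk
      simp only [Int.cast_zero, gu_zero, Real.one_rpow, if_true]
      have := Real.rpow_nonneg (abs_nonneg (0 : ℝ)) (-α)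
      linarith
    · simp only [if_neg hk, add_zero]
      have : (1 : ℝ) ≤ |(k : ℝ)| := by exact_mod_cast Int.one_le_abs hk
      rw [gu, max_eq_right this]

/-- The sum `∑ ⟨k⟩^{-α}` over the integers. -/
def guSum (α : ℝ) : ℝ := ∑' k : ℤ, gu (k : ℝ) ^ (-α)

theorem guSum_nonneg (α : ℝ) : 0 ≤ guSum α := tsum_nonneg fun _ => (gu_rpow_pos _ _).le

theorem hasSum_gu_left {α : ℝ} (hα : 1 < α) (m : ℤ) :
    HasSum (fun k : ℤ => gu ((m : ℝ) - k) ^ (-α)) (guSum α) := by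
  simpa [Function.comp_def, guSum] using
    (Equiv.subLeft m).hasSum_iff.2 (summable_gu_rpow_neg hα).hasSum

theorem hasSum_gu_right {α : ℝ} (hα : 1 < α) (m : ℤ) :
    HasSum (fun k : ℤ => gu ((k : ℝ) - m) ^ (-α)) (guSum α) := by
  simpa only [gu_sub_comm] using hasSum_gu_left hα m

/-- The constant of the polynomial convolution inequality. -/
def convConst (α : ℝ) : ℝ := 2 ^ α * (guSum α + guSum α)

theorem convConst_nonneg (α : ℝ) : 0 ≤ convConst α :=
  mul_nonneg (Real.rpow_nonneg zero_le_two α) (add_nonneg (guSum_nonneg α) (guSum_nonneg α))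

theorem gu_mul_gu_le {α : ℝ} (hα : 0 ≤ α) (x y z : ℝ) :
    gu (x - y) ^ (-α) * gu (y - z) ^ (-α) ≤
      2 ^ α * gu (x - z) ^ (-α) * (gu (x - y) ^ (-α) + gu (y - z) ^ (-α)) := by
  have key : ∀ a b : ℝ, 0 < a → 0 < b → gu (x - z) ≤ 2 * a →
      a ^ (-α) * b ^ (-α) ≤ 2 ^ α * gu (x - z) ^ (-α) * b ^ (-α) := fun a b ha hb hab => by
    refine mul_le_mul_of_nonneg_right ?_ (Real.rpow_nonneg hb.le _)
    have := Real.rpow_le_rpow_of_nonpos (gu_pos (x - z)) hab (neg_nonpos.2 hα)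
    rw [Real.mul_rpow zero_le_two ha.le, Real.rpow_neg zero_le_two] at this
    have h2 : (0 : ℝ) < 2 ^ α := Real.rpow_pos_of_pos zero_lt_two α
    calc a ^ (-α) = 2 ^ α * ((2 ^ α)⁻¹ * a ^ (-α)) := by field_simp
      _ ≤ _ := mul_le_mul_of_nonneg_left this h2.le
  have hxy := gu_rpow_pos (x - y) (-α)
  have hyz := gu_rpow_pos (y - z) (-α)
  have hc : 0 < 2 ^ α * gu (x - z) ^ (-α) :=
    mul_pos (Real.rpow_pos_of_pos zero_lt_two α) (gu_rpow_pos _ _)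
  rw [mul_add]
  have h := gu_sub_le_two_mul_max x y z
  rcases le_total (gu (x - y)) (gu (y - z)) with hle | hle
  · rw [max_eq_right hle] at h
    have := key _ _ (gu_pos _) (gu_pos (x - y)) h
    rw [mul_comm]
    nlinarith [mul_pos hc hyz]
  · rw [max_eq_left hle] at h
    have := key _ _ (gu_pos _) (gu_pos (y - z)) h
    nlinarith [mul_pos hc hxy]

theorem summable_gu_conv {α : ℝ} (hα : 1 < α) (m n : ℤ) :
    Summable fun k : ℤ => gu ((m : ℝ) - k) ^ (-α) * gu ((k : ℝ) - n) ^ (-α) :=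
  (((hasSum_gu_left hα m).add (hasSum_gu_right hα n)).mul_left _).summable.of_nonneg_of_le
    (fun _ => (mul_pos (gu_rpow_pos _ _) (gu_rpow_pos _ _)).le)
    fun _ => gu_mul_gu_le (zero_le_one.trans hα.le) _ _ _

theorem tsum_gu_conv_le {α : ℝ} (hα : 1 < α) (m n : ℤ) :
    ∑' k : ℤ, gu ((m : ℝ) - k) ^ (-α) * gu ((k : ℝ) - n) ^ (-α) ≤
      convConst α * gu ((m : ℝ) - n) ^ (-α) := by
  have h := (((hasSum_gu_left hα m).add (hasSum_gu_right hα n)).mul_left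
    (2 ^ α * gu ((m : ℝ) - n) ^ (-α)))
  refine ((summable_gu_conv hα m n).tsum_le_of_sum_le fun S => ?_)
  refine (Finset.sum_le_sum fun (k : ℤ) _ =>
    gu_mul_gu_le (zero_le_one.trans hα.le) (m : ℝ) k n).trans ?_
  refine (sum_le_hasSum S (fun k _ => ?_) h).trans_eq (by rw [convConst]; ring)
  exact mul_nonneg (mul_pos (Real.rpow_pos_of_pos zero_lt_two α) (gu_rpow_pos _ _)).le
    (add_pos (gu_rpow_pos _ _) (gu_rpow_pos _ _)).le

theorem abs_rpow_sub_rpow_le {a b d β : ℝ} (ha : 1 ≤ a) (hb : 1 ≤ b) (hβ : 1 ≤ β)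
    (hd : 1 ≤ d) (hab : |a - b| ≤ d) :
    |a ^ β - b ^ β| ≤ β * 2 ^ (β - 1) * (b ^ (β - 1) * d + d ^ β) := by
  have bern : ∀ x y : ℝ, 0 < y → y ≤ x → x ^ β - y ^ β ≤ β * x ^ (β - 1) * (x - y) := by
    intro x y hy hxy
    have hx := hy.trans_le hxy
    have h := one_add_mul_self_le_rpow_one_add (s := y / x - 1)
      (by linarith [div_pos hy hx]) hβ
    rw [add_sub_cancel, Real.div_rpow hy.le hx.le, le_div_iff₀ (Real.rpow_pos_of_pos hx β)] at h
    have h2 : x ^ β = x ^ (β - 1) * x := by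
      rw [← Real.rpow_add_one hx.ne', sub_add_cancel]
    have h3 : (1 + β * (y / x - 1)) * x ^ β = x ^ β - β * x ^ (β - 1) * (x - y) := by
      rw [h2]; field_simp; ring
    linarith
  have ha0 := zero_lt_one.trans_le ha
  have hb0 := zero_lt_one.trans_le hb
  have hd0 := zero_lt_one.trans_le hd
  have hβ0 : 0 ≤ β - 1 := by linarith
  have hmax : |a ^ β - b ^ β| ≤ β * (b + d) ^ (β - 1) * d := by
    rcases le_total b a with h | h
    · rw [abs_of_nonneg (sub_nonneg.2 (Real.rpow_le_rpow hb0.le h (by linarith)))]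
      rw [abs_of_nonneg (sub_nonneg.2 h)] at hab
      refine (bern a b hb0 h).trans ?_
      gcongr
      linarith
    · rw [abs_sub_comm, abs_of_nonneg (sub_nonneg.2 (Real.rpow_le_rpow ha0.le h (by linarith)))]
      rw [abs_sub_comm, abs_of_nonneg (sub_nonneg.2 h)] at hab
      refine (bern b a ha0 h).trans ?_
      gcongr
      linarith
  have hsplit : (b + d) ^ (β - 1) ≤ 2 ^ (β - 1) * (b ^ (β - 1) + d ^ (β - 1)) := by
    have hbp := Real.rpow_nonneg hb0.le (β - 1)
    have hdp := Real.rpow_nonneg hd0.le (β - 1)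
    have h2p : (0 : ℝ) ≤ 2 ^ (β - 1) := Real.rpow_nonneg zero_le_two _
    rcases le_total b d with h | h
    · calc (b + d) ^ (β - 1) ≤ (2 * d) ^ (β - 1) := by gcongr; linarith
        _ = 2 ^ (β - 1) * d ^ (β - 1) := Real.mul_rpow zero_le_two hd0.le
        _ ≤ _ := by gcongr; linarith
    · calc (b + d) ^ (β - 1) ≤ (2 * b) ^ (β - 1) := by gcongr; linarith
        _ = 2 ^ (β - 1) * b ^ (β - 1) := Real.mul_rpow zero_le_two hb0.le
        _ ≤ _ := by gcongr; linarith
  have hdβ : d ^ β = d ^ (β - 1) * d := by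
    rw [← Real.rpow_add_one hd0.ne', sub_add_cancel]
  calc |a ^ β - b ^ β| ≤ β * (b + d) ^ (β - 1) * d := hmax
    _ ≤ β * (2 ^ (β - 1) * (b ^ (β - 1) + d ^ (β - 1))) * d := by gcongr
    _ = _ := by rw [hdβ]; ring

/-- Cauchy–Schwarz for nonnegative real sequences. -/
theorem summable_mul_and_sq_tsum_mul_le {ι : Type*} {f g : ι → ℝ} (hf : ∀ i, 0 ≤ f i)
    (hg : ∀ i, 0 ≤ g i) (hf2 : Summable fun i => f i ^ 2) (hg2 : Summable fun i => g i ^ 2) :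
    (Summable fun i => f i * g i) ∧
      (∑' i, f i * g i) ^ 2 ≤ (∑' i, f i ^ 2) * ∑' i, g i ^ 2 := by
  have h := Real.summable_and_inner_le_Lp_mul_Lq_tsum_of_nonneg Real.HolderConjugate.two_two hf hg
    (by simpa using hf2) (by simpa using hg2)
  refine ⟨h.1, ?_⟩
  have h2 := h.2
  simp only [Real.rpow_two, ← Real.sqrt_eq_rpow] at h2
  have h0 : 0 ≤ ∑' i, f i * g i := tsum_nonneg fun i => mul_nonneg (hf i) (hg i)
  calc _ ≤ (√(∑' i, f i ^ 2) * √(∑' i, g i ^ 2)) ^ 2 := by gcongr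
    _ = _ := by
      rw [mul_pow, Real.sq_sqrt (tsum_nonneg fun i => sq_nonneg _),
        Real.sq_sqrt (tsum_nonneg fun i => sq_nonneg _)]

/-- Square-summable two-sided sequences with values in `V`. -/
abbrev SeqL2 (V : Type*) [NormedAddCommGroup V] : Type _ := lp (fun _ : ℤ => V) 2

section Blocks

variable {U V W : Type*} [NormedAddCommGroup U] [InnerProductSpace ℝ U]
  [NormedAddCommGroup V] [InnerProductSpace ℝ V] [NormedAddCommGroup W] [InnerProductSpace ℝ W]

/-- The `(s, s')` block of an operator between sequence spaces. -/
def opBlk (A : SeqL2 V →L[ℝ] SeqL2 W) (s s' : ℤ) : V →L[ℝ] W :=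
  (lp.evalCLM ℝ (fun _ : ℤ => W) 2 s).comp
    (A.comp (lp.singleContinuousLinearMap ℝ (fun _ : ℤ => V) 2 s'))

theorem opBlk_apply (A : SeqL2 V →L[ℝ] SeqL2 W) (s s' : ℤ) (v : V) :
    opBlk A s s' v = A (lp.single 2 s' v) s := rfl

theorem opBlk_sub (A B : SeqL2 V →L[ℝ] SeqL2 W) (s s' : ℤ) :
    opBlk (A - B) s s' = opBlk A s s' - opBlk B s s' := by
  ext v
  simp [opBlk_apply]

theorem hasSum_opBlk (A : SeqL2 V →L[ℝ] SeqL2 W) (x : SeqL2 V) (s : ℤ) :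
    HasSum (fun s' => opBlk A s s' (x s')) (A x s) :=
  ((lp.hasSum_single (by simp) x).mapL A).mapL (lp.evalCLM ℝ (fun _ : ℤ => W) 2 s)

theorem norm_opBlk_comp_le (A : SeqL2 V →L[ℝ] SeqL2 W) (B : SeqL2 U →L[ℝ] SeqL2 V)
    (s s'' : ℤ) {f : ℤ → ℝ} (hf : Summable f)
    (h : ∀ s', ‖opBlk A s s'‖ * ‖opBlk B s' s''‖ ≤ f s') :
    ‖opBlk (A.comp B) s s''‖ ≤ ∑' s', f s' := by
  have hf0 : ∀ s', 0 ≤ f s' := fun s' => le_trans (by positivity) (h s')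
  refine ContinuousLinearMap.opNorm_le_bound _ (tsum_nonneg hf0) fun v => ?_
  have hsum := hasSum_opBlk A (B (lp.single 2 s'' v)) s
  rw [← tsum_mul_right]
  refine hsum.norm_le_of_bounded (hf.mul_right ‖v‖).hasSum fun s' => ?_
  calc ‖opBlk A s s' (opBlk B s' s'' v)‖ ≤ ‖opBlk A s s'‖ * (‖opBlk B s' s''‖ * ‖v‖) :=
        (opBlk A s s').le_opNorm_of_le ((opBlk B s' s'').le_opNorm v)
    _ = ‖opBlk A s s'‖ * ‖opBlk B s' s''‖ * ‖v‖ := by ring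
    _ ≤ f s' * ‖v‖ := by gcongr; exact h s'

theorem norm_opBlk_adjoint [CompleteSpace V] [CompleteSpace W] (A : SeqL2 V →L[ℝ] SeqL2 W)
    (s s' : ℤ) : ‖opBlk (ContinuousLinearMap.adjoint A) s s'‖ = ‖opBlk A s' s‖ := by
  have : opBlk (ContinuousLinearMap.adjoint A) s s' =
      ContinuousLinearMap.adjoint (opBlk A s' s) := by
    rw [ContinuousLinearMap.eq_adjoint_iff]
    intro w v
    exact (lp.inner_single_right s v (ContinuousLinearMap.adjoint A (lp.single 2 s' w))).symm.trans
      ((ContinuousLinearMap.adjoint_inner_left A _ _).trans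
        (lp.inner_single_left s' w (A (lp.single 2 s v))))
  rw [this, LinearIsometryEquiv.norm_map]

theorem norm_opBlk_comp_le_conv (A : SeqL2 V →L[ℝ] SeqL2 W) (B : SeqL2 U →L[ℝ] SeqL2 V)
    {α c : ℝ} (hα : 1 < α) (hc : 0 ≤ c) (s s'' : ℤ)
    (h : ∀ s' : ℤ, ‖opBlk A s s'‖ * ‖opBlk B s' s''‖ ≤
      c * (gu ((s : ℝ) - s') ^ (-α) * gu ((s' : ℝ) - s'') ^ (-α))) :
    ‖opBlk (A.comp B) s s''‖ ≤ c * convConst α * gu ((s : ℝ) - s'') ^ (-α) := by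
  refine (norm_opBlk_comp_le A B s s'' ((summable_gu_conv hα s s'').mul_left c) h).trans ?_
  rw [tsum_mul_left, mul_assoc]
  exact mul_le_mul_of_nonneg_left (tsum_gu_conv_le hα s s'') hc

theorem norm_opBlk_comp_le_of_le (A : SeqL2 V →L[ℝ] SeqL2 W) (B : SeqL2 U →L[ℝ] SeqL2 V)
    {α a b : ℝ} (hα : 1 < α) (ha : 0 ≤ a) (hb : 0 ≤ b) (s s'' : ℤ)
    (hA : ∀ s' : ℤ, ‖opBlk A s s'‖ ≤ a * gu ((s : ℝ) - s') ^ (-α))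
    (hB : ∀ s' : ℤ, ‖opBlk B s' s''‖ ≤ b * gu ((s' : ℝ) - s'') ^ (-α)) :
    ‖opBlk (A.comp B) s s''‖ ≤ a * b * convConst α * gu ((s : ℝ) - s'') ^ (-α) := by
  refine norm_opBlk_comp_le_conv A B hα (mul_nonneg ha hb) s s'' fun s' => ?_
  refine (mul_le_mul (hA s') (hB s') (norm_nonneg _)
    (mul_nonneg ha (gu_rpow_pos _ _).le)).trans_eq (by ring)

end Blocks

section Weighted

variable {V : Type*} [NormedAddCommGroup V]

theorem sum_sq_norm_le (x : SeqL2 V) (S : Finset ℤ) : ∑ s ∈ S, ‖x s‖ ^ 2 ≤ ‖x‖ ^ 2 := by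
  simpa using lp.sum_rpow_le_norm_rpow (by simp) x S

theorem norm_sq_le_of_forall_sum_le (x : SeqL2 V) {C : ℝ}
    (h : ∀ S : Finset ℤ, ∑ s ∈ S, ‖x s‖ ^ 2 ≤ C) : ‖x‖ ^ 2 ≤ C := by
  have hC : 0 ≤ C := by simpa using h ∅
  have := lp.norm_le_of_forall_sum_le (p := 2) (by simp) (Real.sqrt_nonneg C) (f := x)
    fun S => by simpa [Real.sq_sqrt hC] using h S
  calc ‖x‖ ^ 2 ≤ √C ^ 2 := by gcongr
    _ = C := Real.sq_sqrt hC

/-- Schur's test for the polynomial kernel. -/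
theorem summable_and_sum_sq_gu_conv_le {α : ℝ} (hα : 1 < α) {f : ℤ → ℝ} (hf : ∀ s, 0 ≤ f s)
    {C : ℝ} (hC : ∀ S : Finset ℤ, ∑ s ∈ S, f s ^ 2 ≤ C) :
    (∀ s : ℤ, Summable fun s' : ℤ => gu ((s : ℝ) - s') ^ (-α) * f s') ∧
      ∀ S : Finset ℤ, ∑ s ∈ S, (∑' s' : ℤ, gu ((s : ℝ) - s') ^ (-α) * f s') ^ 2 ≤
        guSum α ^ 2 * C := by
  have hfs : Summable fun s => f s ^ 2 := summable_of_sum_le (fun s => sq_nonneg _) hC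
  have hle1 : ∀ x : ℝ, gu x ^ (-α) ≤ 1 := fun x =>
    Real.rpow_le_one_of_one_le_of_nonpos (one_le_gu x) (by linarith)
  have hsq : ∀ x : ℝ, (gu x ^ (-α / 2)) ^ 2 = gu x ^ (-α) := fun x => by
    rw [← Real.rpow_natCast, ← Real.rpow_mul (gu_pos x).le]
    congr 1
    push_cast
    ring
  have hks : ∀ s : ℤ, Summable fun s' : ℤ => gu ((s : ℝ) - s') ^ (-α) * f s' ^ 2 := fun s =>
    hfs.of_nonneg_of_le (fun s' => mul_nonneg (gu_rpow_pos _ _).le (sq_nonneg _))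
      fun s' => mul_le_of_le_one_left (sq_nonneg _) (hle1 _)
  have hprod : ∀ s s' : ℤ, gu ((s : ℝ) - s') ^ (-α) * f s' =
      gu ((s : ℝ) - s') ^ (-α / 2) * (gu ((s : ℝ) - s') ^ (-α / 2) * f s') := fun s s' => by
    rw [← hsq, sq, mul_assoc]
  have hcs := fun s : ℤ => summable_mul_and_sq_tsum_mul_le
    (f := fun s' : ℤ => gu ((s : ℝ) - s') ^ (-α / 2))
    (g := fun s' : ℤ => gu ((s : ℝ) - s') ^ (-α / 2) * f s')
    (fun s' => (gu_rpow_pos _ _).le) (fun s' => mul_nonneg (gu_rpow_pos _ _).le (hf s'))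
    (by simpa only [hsq] using (hasSum_gu_left hα s).summable)
    (by simpa only [mul_pow, hsq] using hks s)
  simp only [mul_pow, hsq, ← hprod, (hasSum_gu_left hα _).tsum_eq] at hcs
  refine ⟨fun s => (hcs s).1, fun S => (Finset.sum_le_sum fun s _ => (hcs s).2).trans ?_⟩
  rw [← Finset.mul_sum, ← Summable.tsum_finsetSum fun s _ => hks s, sq, mul_assoc]
  refine mul_le_mul_of_nonneg_left ?_ (guSum_nonneg α)
  calc ∑' s' : ℤ, ∑ s ∈ S, gu ((s : ℝ) - s') ^ (-α) * f s' ^ 2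
      ≤ ∑' s' : ℤ, guSum α * f s' ^ 2 := by
        refine (summable_sum fun s _ => hks s).tsum_le_tsum (fun s' => ?_) (hfs.mul_left _)
        rw [← Finset.sum_mul]
        exact mul_le_mul_of_nonneg_right
          (sum_le_hasSum S (fun s _ => (gu_rpow_pos _ _).le) (hasSum_gu_right hα s'))
          (sq_nonneg _)
    _ = guSum α * ∑' s', f s' ^ 2 := tsum_mul_left
    _ ≤ guSum α * C := mul_le_mul_of_nonneg_left (hfs.tsum_le_of_sum_le hC) (guSum_nonneg α)

/-- Hilbert–Schmidt bound for the kernel `⟨s - s'⟩⁻¹ ⟨s' - τ⟩⁻¹`. -/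
theorem summable_and_sum_sq_gu_inv_conv_le (τ : ℤ) {h : ℤ → ℝ} (hh : ∀ s, 0 ≤ h s)
    {C : ℝ} (hC : ∀ S : Finset ℤ, ∑ s ∈ S, (gu ((s : ℝ) - τ) * h s) ^ 2 ≤ C) :
    (∀ s : ℤ, Summable fun s' : ℤ => (gu ((s : ℝ) - s'))⁻¹ * h s') ∧
      ∀ S : Finset ℤ, ∑ s ∈ S, (∑' s' : ℤ, (gu ((s : ℝ) - s'))⁻¹ * h s') ^ 2 ≤
        convConst 2 * guSum 2 * C := by
  have hfs : Summable fun s : ℤ => (gu ((s : ℝ) - τ) * h s) ^ 2 :=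
    summable_of_sum_le (fun s => sq_nonneg _) hC
  have hsq : ∀ x : ℝ, (gu x)⁻¹ ^ 2 = gu x ^ (-2 : ℝ) := fun x => by
    rw [Real.rpow_neg (gu_pos x).le, Real.rpow_two, inv_pow]
  have hprod : ∀ s s' : ℤ, (gu ((s : ℝ) - s'))⁻¹ * h s' =
      (gu ((s : ℝ) - s'))⁻¹ * (gu ((s' : ℝ) - τ))⁻¹ * (gu ((s' : ℝ) - τ) * h s') := fun s s' => by
    have := (gu_pos ((s' : ℝ) - τ)).ne'
    field_simp
  have hcs := fun s : ℤ => summable_mul_and_sq_tsum_mul_le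
    (f := fun s' : ℤ => (gu ((s : ℝ) - s'))⁻¹ * (gu ((s' : ℝ) - τ))⁻¹)
    (g := fun s' : ℤ => gu ((s' : ℝ) - τ) * h s')
    (fun s' => (mul_pos (inv_pos.2 (gu_pos _)) (inv_pos.2 (gu_pos _))).le)
    (fun s' => mul_nonneg (gu_pos _).le (hh s'))
    (by simpa only [mul_pow, hsq] using summable_gu_conv one_lt_two s τ) hfs
  have h0 : 0 ≤ ∑' s : ℤ, (gu ((s : ℝ) - τ) * h s) ^ 2 := tsum_nonneg fun _ => sq_nonneg _
  have hCs := hfs.tsum_le_of_sum_le hC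
  have hC0 := h0.trans hCs
  simp only [← hprod] at hcs
  refine ⟨fun s => (hcs s).1, fun S => ?_⟩
  calc ∑ s ∈ S, (∑' s' : ℤ, (gu ((s : ℝ) - s'))⁻¹ * h s') ^ 2
      ≤ ∑ s ∈ S, convConst 2 * gu ((s : ℝ) - τ) ^ (-2 : ℝ) * C := by
        refine Finset.sum_le_sum fun s _ => (hcs s).2.trans ?_
        refine mul_le_mul ?_ hCs h0 (mul_nonneg (convConst_nonneg 2) (gu_rpow_pos _ _).le)
        simpa only [mul_pow, hsq] using tsum_gu_conv_le one_lt_two s τ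
    _ = convConst 2 * (∑ s ∈ S, gu ((s : ℝ) - τ) ^ (-2 : ℝ)) * C := by
        rw [← Finset.sum_mul, ← Finset.mul_sum]
    _ ≤ convConst 2 * guSum 2 * C := by
        refine mul_le_mul_of_nonneg_right (mul_le_mul_of_nonneg_left ?_ (convConst_nonneg 2)) hC0
        exact sum_le_hasSum S (fun s _ => (gu_rpow_pos _ _).le) (hasSum_gu_right one_lt_two τ)

variable [InnerProductSpace ℝ V]

/-- The pointwise product of a bounded weight with a square-summable sequence. -/
theorem exists_weighted (x : SeqL2 V) {w : ℤ → ℝ} {M : ℝ} (hw : ∀ s, |w s| ≤ M) :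
    ∃ y : SeqL2 V, ∀ s, y s = w s • x s := by
  refine ⟨⟨fun s => w s • x s, ?_⟩, fun _ => rfl⟩
  have hx : Summable fun s => ‖x s‖ ^ 2 := by
    simpa using (lp.memℓp x).summable (by simp)
  refine memℓp_gen ((hx.mul_left (M ^ 2)).of_nonneg_of_le (fun s => by positivity) fun s => ?_)
  simp only [ENNReal.toReal_ofNat, Real.rpow_two, norm_smul, mul_pow, Real.norm_eq_abs]
  have := hw s
  gcongr

/-- The column `x = A⁻¹ (δ_τ ⊗ e)` of the inverse of a coercive operator with polynomial
off-diagonal decay. -/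
structure IsInverseColumn (K κ lam : ℝ) (A : SeqL2 V →L[ℝ] SeqL2 V) (x : SeqL2 V) (τ : ℤ)
    (e : V) : Prop where
  decay : ∀ s s' : ℤ, ‖opBlk A s s'‖ ≤ K * gu ((s : ℝ) - s') ^ (-κ)
  coercive : ∀ y : SeqL2 V, lam * ‖y‖ ^ 2 ≤ inner ℝ y (A y)
  apply_eq : A x = lp.single 2 τ e

variable {K κ lam : ℝ} {A : SeqL2 V →L[ℝ] SeqL2 V} {x : SeqL2 V} {τ : ℤ} {e : V}

theorem sq_mul_norm_sq_le_of_coercive (hlam : 0 < lam)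
    (hA : ∀ y : SeqL2 V, lam * ‖y‖ ^ 2 ≤ inner ℝ y (A y)) (y : SeqL2 V) :
    lam ^ 2 * ‖y‖ ^ 2 ≤ ‖A y‖ ^ 2 := by
  have h1 := (hA y).trans (real_inner_le_norm y (A y))
  rcases (norm_nonneg y).eq_or_lt with h0 | h0
  · rw [← h0]; simp
  · have h2 : lam * ‖y‖ ≤ ‖A y‖ := by
      refine le_of_mul_le_mul_left ?_ h0
      calc ‖y‖ * (lam * ‖y‖) = lam * ‖y‖ ^ 2 := by ring
        _ ≤ _ := h1
    rw [← mul_pow]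
    gcongr

/-- Energy estimate for a bounded weight. -/
theorem IsInverseColumn.sum_sq_weight_le (hx : IsInverseColumn K κ lam A x τ e) (hlam : 0 < lam)
    {w : ℤ → ℝ} {M : ℝ} (hw : ∀ s, |w s| ≤ M) (hwτ : w τ = 1) {k : ℤ → ℤ → ℝ}
    (hk : ∀ s, Summable (k s))
    (hle : ∀ s s' : ℤ, K * gu ((s : ℝ) - s') ^ (-κ) * (|w s' - w s| * ‖x s'‖) ≤ k s s')
    {ρ : ℝ} (hρ : ∀ S : Finset ℤ, ∑ s ∈ S, (∑' s', k s s') ^ 2 ≤ ρ) (S : Finset ℤ) :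
    ∑ s ∈ S, (w s * ‖x s‖) ^ 2 ≤ 2 * (‖e‖ ^ 2 + ρ) / lam ^ 2 := by
  obtain ⟨y, hy⟩ := exists_weighted x hw
  have hAy : ∀ s, ‖A y s‖ ≤ ‖(lp.single 2 τ e : SeqL2 V) s‖ + ∑' s', k s s' := by
    intro s
    have h1 := (hasSum_opBlk A y s).sub ((hasSum_opBlk A x s).const_smul (w s))
    have h2 : ‖A y s - w s • A x s‖ ≤ ∑' s', k s s' := by
      refine h1.norm_le_of_bounded (hk s).hasSum fun s' => ?_
      rw [hy, ← map_smul, ← map_sub, ← sub_smul]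
      refine ((opBlk A s s').le_opNorm _).trans (le_trans ?_ (hle s s'))
      rw [norm_smul, Real.norm_eq_abs]
      exact mul_le_mul_of_nonneg_right (hx.decay s s') (by positivity)
    have h3 : w s • A x s = (lp.single 2 τ e : SeqL2 V) s := by
      rw [hx.apply_eq]
      by_cases hs : s = τ
      · rw [hs, hwτ, one_smul]
      · have h0 : (lp.single 2 τ e : SeqL2 V) s = 0 :=
          lp.single_apply_ne (E := fun _ : ℤ => V) 2 τ e hs
        rw [h0, smul_zero]
    rw [h3] at h2
    calc ‖A y s‖ = ‖(lp.single 2 τ e : SeqL2 V) s + (A y s - (lp.single 2 τ e : SeqL2 V) s)‖ := by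
          rw [add_sub_cancel]
      _ ≤ _ := (norm_add_le _ _).trans (add_le_add_right h2 _)
  have hnorm : ‖A y‖ ^ 2 ≤ 2 * (‖e‖ ^ 2 + ρ) := by
    refine norm_sq_le_of_forall_sum_le _ fun T => ?_
    have h4 : ∑ s ∈ T, ‖(lp.single 2 τ e : SeqL2 V) s‖ ^ 2 ≤ ‖e‖ ^ 2 :=
      (sum_sq_norm_le _ T).trans_eq (by rw [lp.norm_single (by simp)])
    calc ∑ s ∈ T, ‖A y s‖ ^ 2
        ≤ ∑ s ∈ T, 2 * (‖(lp.single 2 τ e : SeqL2 V) s‖ ^ 2 + (∑' s', k s s') ^ 2) := by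
          refine Finset.sum_le_sum fun s _ => ?_
          exact (pow_le_pow_left₀ (norm_nonneg _) (hAy s) 2).trans add_sq_le
      _ ≤ _ := by
          rw [← Finset.mul_sum, Finset.sum_add_distrib]
          linarith [hρ T]
  rw [le_div_iff₀ (by positivity), mul_comm]
  refine le_trans ?_ ((sq_mul_norm_sq_le_of_coercive hlam hx.coercive y).trans hnorm)
  refine mul_le_mul_of_nonneg_left ?_ (by positivity)
  refine le_trans (Finset.sum_le_sum fun s _ => ?_) (sum_sq_norm_le y S)
  rw [hy, norm_smul, mul_pow, mul_pow, Real.norm_eq_abs, sq_abs]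

/-- Energy estimate for the weight `⟨s - τ⟩^β`. -/
theorem IsInverseColumn.sum_sq_gu_rpow_le (hx : IsInverseColumn K κ lam A x τ e) (hlam : 0 < lam)
    (hK : 0 ≤ K) {β : ℝ} {k : ℤ → ℤ → ℝ} (hk : ∀ s, Summable (k s))
    (hle : ∀ s s' : ℤ, K * gu ((s : ℝ) - s') ^ (-κ) *
      (|gu ((s : ℝ) - τ) ^ β - gu ((s' : ℝ) - τ) ^ β| * ‖x s'‖) ≤ k s s')
    {ρ : ℝ} (hρ : ∀ S : Finset ℤ, ∑ s ∈ S, (∑' s', k s s') ^ 2 ≤ ρ) (S : Finset ℤ) :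
    ∑ s ∈ S, (gu ((s : ℝ) - τ) ^ β * ‖x s‖) ^ 2 ≤ 2 * (‖e‖ ^ 2 + ρ) / lam ^ 2 := by
  set M : ℝ := 1 + ∑ s ∈ S, gu ((s : ℝ) - τ) ^ β with hM
  have hM1 : 1 ≤ M := le_add_of_nonneg_right (Finset.sum_nonneg fun s _ => (gu_rpow_pos _ _).le)
  have hmin : ∀ s ∈ S, min (gu ((s : ℝ) - τ) ^ β) M = gu ((s : ℝ) - τ) ^ β := fun s hs => by
    refine min_eq_left ?_
    have := Finset.single_le_sum (f := fun s : ℤ => gu ((s : ℝ) - τ) ^ β)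
      (fun s _ => (gu_rpow_pos _ _).le) hs
    linarith
  have h := hx.sum_sq_weight_le hlam (w := fun s : ℤ => min (gu ((s : ℝ) - τ) ^ β) M) (M := M)
    (fun s => ?_) ?_ hk (fun s s' => le_trans ?_ (hle s s')) hρ S
  · refine le_trans (Finset.sum_le_sum fun s hs => ?_) h
    simp only [hmin s hs, le_refl]
  · rw [abs_of_nonneg (le_min (gu_rpow_pos _ _).le (zero_le_one.trans hM1))]
    exact min_le_right _ _
  · simp only [sub_self, gu_zero, Real.one_rpow, min_eq_left hM1]
  · have := gu_rpow_pos ((s : ℝ) - s') (-κ)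
    have h1 := abs_min_sub_min_le_max (gu ((s : ℝ) - τ) ^ β) M (gu ((s' : ℝ) - τ) ^ β) M
    rw [sub_self, abs_zero, max_eq_left (abs_nonneg _)] at h1
    rw [abs_sub_comm]
    gcongr

end Weighted

section InverseDecay

/-- Uniform `ℓ²` bound for the columns of inverses, with weight `⟨s - τ⟩^β`. -/
def InverseColumnBound (K κ lam β : ℝ) : Prop :=
  ∃ C : ℝ, 0 ≤ C ∧ ∀ (V : Type) [NormedAddCommGroup V] [InnerProductSpace ℝ V]
    (A : SeqL2 V →L[ℝ] SeqL2 V) (x : SeqL2 V) (τ : ℤ) (e : V), IsInverseColumn K κ lam A x τ e →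
    ∀ S : Finset ℤ, ∑ s ∈ S, (gu ((s : ℝ) - τ) ^ β * ‖x s‖) ^ 2 ≤ C * ‖e‖ ^ 2

variable {K κ lam β : ℝ}

theorem InverseColumnBound.mono {γ : ℝ} (h : InverseColumnBound K κ lam γ) (hβ : β ≤ γ) :
    InverseColumnBound K κ lam β := by
  obtain ⟨C, hC, h⟩ := h
  refine ⟨C, hC, fun V _ _ A x τ e hx S => le_trans (Finset.sum_le_sum fun s _ => ?_)
    (h V A x τ e hx S)⟩
  have := Real.rpow_le_rpow_of_exponent_le (one_le_gu ((s : ℝ) - τ)) hβ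
  have := gu_rpow_pos ((s : ℝ) - τ) β
  gcongr

theorem inverseColumnBound_zero (hK : 0 ≤ K) (hlam : 0 < lam) :
    InverseColumnBound K κ lam 0 := by
  refine ⟨2 / lam ^ 2, by positivity, fun V _ _ A x τ e hx S => ?_⟩
  refine (hx.sum_sq_gu_rpow_le hlam hK (k := fun _ _ => 0) (ρ := 0) (fun _ => summable_zero)
    (fun s s' => by simp) (fun S => by simp) S).trans_eq (by ring)

theorem inverseColumnBound_one (hK : 0 ≤ K) (hlam : 0 < lam) (hκ : 3 < κ) :
    InverseColumnBound K κ lam 1 := by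
  obtain ⟨C, hC, h⟩ := inverseColumnBound_zero (κ := κ) hK hlam
  refine ⟨2 * (1 + K ^ 2 * (guSum (κ - 1) ^ 2 * C)) / lam ^ 2, by positivity,
    fun V _ _ A x τ e hx S => ?_⟩
  have hx0 := h V A x τ e hx
  simp only [Real.rpow_zero, one_mul] at hx0
  obtain ⟨h1, h2⟩ := summable_and_sum_sq_gu_conv_le (α := κ - 1) (by linarith)
    (fun s => norm_nonneg (x s)) hx0
  refine (hx.sum_sq_gu_rpow_le hlam hK
    (k := fun s s' => K * (gu ((s : ℝ) - s') ^ (-(κ - 1)) * ‖x s'‖))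
    (ρ := K ^ 2 * (guSum (κ - 1) ^ 2 * (C * ‖e‖ ^ 2))) (fun s => (h1 s).mul_left K)
    (fun s s' => ?_) (fun S => ?_) S).trans_eq (by ring)
  · have hd := abs_gu_sub_gu_le (s : ℝ) s' τ
    have hg := gu_rpow_pos ((s : ℝ) - s') (-κ)
    have : gu ((s : ℝ) - s') ^ (-(κ - 1)) = gu ((s : ℝ) - s') ^ (-κ) * gu ((s : ℝ) - s') := by
      rw [← Real.rpow_add_one (gu_pos _).ne']; ring_nf
    rw [this, Real.rpow_one, Real.rpow_one, mul_assoc, mul_assoc]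
    gcongr
  · simp only [tsum_mul_left, mul_pow, ← Finset.mul_sum]
    exact mul_le_mul_of_nonneg_left (h2 S) (sq_nonneg K)

theorem inverseColumnBound_step (hK : 0 ≤ K) (hlam : 0 < lam) (hκ : 3 < κ) (hβ : 1 ≤ β)
    (hβκ : β ≤ κ - 1) (h : InverseColumnBound K κ lam (β - 1)) :
    InverseColumnBound K κ lam β := by
  obtain ⟨C, hC, h⟩ := h
  obtain ⟨D, hD, h'⟩ := inverseColumnBound_one hK hlam hκ
  set c : ℝ := K * (β * 2 ^ (β - 1)) with hc
  have hc0 : 0 ≤ c := by positivity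
  have hcc := convConst_nonneg 2
  have hgs := guSum_nonneg 2
  refine ⟨2 * (1 + c ^ 2 * (2 * (guSum (κ - 1) ^ 2 * C + convConst 2 * guSum 2 * D))) / lam ^ 2,
    by positivity, fun V _ _ A x τ e hx S => ?_⟩
  have hx1 := h' V A x τ e hx
  simp only [Real.rpow_one] at hx1
  obtain ⟨h1, h2⟩ := summable_and_sum_sq_gu_conv_le (α := κ - 1) (by linarith)
    (fun s => mul_nonneg (gu_rpow_pos _ _).le (norm_nonneg (x s))) (h V A x τ e hx)
  obtain ⟨h3, h4⟩ := summable_and_sum_sq_gu_inv_conv_le τ (fun s => norm_nonneg (x s)) hx1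
  refine (hx.sum_sq_gu_rpow_le hlam hK
    (k := fun s s' => c * (gu ((s : ℝ) - s') ^ (-(κ - 1)) *
      (gu ((s' : ℝ) - τ) ^ (β - 1) * ‖x s'‖) + (gu ((s : ℝ) - s'))⁻¹ * ‖x s'‖))
    (ρ := c ^ 2 * (2 * (guSum (κ - 1) ^ 2 * (C * ‖e‖ ^ 2) +
      convConst 2 * guSum 2 * (D * ‖e‖ ^ 2)))) (fun s => ((h1 s).add (h3 s)).mul_left c)
    (fun s s' => ?_) (fun S => ?_) S).trans_eq (by ring)
  · have hd := abs_rpow_sub_rpow_le (one_le_gu ((s : ℝ) - τ)) (one_le_gu ((s' : ℝ) - τ)) hβ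
      (one_le_gu ((s : ℝ) - s')) (abs_gu_sub_gu_le (s : ℝ) s' τ)
    have hg := gu_rpow_pos ((s : ℝ) - s') (-κ)
    have e1 : gu ((s : ℝ) - s') ^ (-(κ - 1)) = gu ((s : ℝ) - s') ^ (-κ) * gu ((s : ℝ) - s') := by
      rw [← Real.rpow_add_one (gu_pos _).ne']; ring_nf
    have e2 : gu ((s : ℝ) - s') ^ (-κ) * gu ((s : ℝ) - s') ^ β ≤ (gu ((s : ℝ) - s'))⁻¹ := by
      rw [← Real.rpow_add (gu_pos _), ← Real.rpow_neg_one]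
      exact Real.rpow_le_rpow_of_exponent_le (one_le_gu _) (by linarith)
    calc _ ≤ K * gu ((s : ℝ) - s') ^ (-κ) * (β * 2 ^ (β - 1) *
          (gu ((s' : ℝ) - τ) ^ (β - 1) * gu ((s : ℝ) - s') + gu ((s : ℝ) - s') ^ β) * ‖x s'‖) := by
          gcongr
      _ = c * (gu ((s : ℝ) - s') ^ (-κ) * gu ((s : ℝ) - s') *
          (gu ((s' : ℝ) - τ) ^ (β - 1) * ‖x s'‖) +
          gu ((s : ℝ) - s') ^ (-κ) * gu ((s : ℝ) - s') ^ β * ‖x s'‖) := by rw [hc]; ring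
      _ ≤ _ := by rw [e1]; gcongr
  · simp only [tsum_mul_left, mul_pow, ← Finset.mul_sum, fun s => (h1 s).tsum_add (h3 s)]
    refine mul_le_mul_of_nonneg_left ?_ (sq_nonneg c)
    refine (Finset.sum_le_sum fun s _ => add_sq_le).trans ?_
    rw [← Finset.mul_sum, Finset.sum_add_distrib]
    exact mul_le_mul_of_nonneg_left (add_le_add (h2 S) (h4 S)) zero_le_two

theorem inverseColumnBound (hK : 0 ≤ K) (hlam : 0 < lam) (hκ : 3 < κ) :
    InverseColumnBound K κ lam (κ - 1) := by
  have key : ∀ (n : ℕ) (β : ℝ), β ≤ n → β ≤ κ - 1 → InverseColumnBound K κ lam β := by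
    intro n
    induction n with
    | zero =>
      intro β hβ _
      exact (inverseColumnBound_zero hK hlam).mono (by simpa using hβ)
    | succ n ih =>
      intro β hβ hβκ
      rcases le_total β 1 with h1 | h1
      · exact (inverseColumnBound_one hK hlam hκ).mono h1
      · push_cast at hβ
        exact inverseColumnBound_step hK hlam hκ h1 hβκ (ih _ (by linarith) (by linarith))
  obtain ⟨n, hn⟩ := exists_nat_ge (κ - 1)
  exact key n _ hn le_rfl

/-- Inverses of coercive operators with decay `⟨s - s'⟩^{-κ}` decay at least as fast as
`⟨s - s'⟩^{-(κ - 1)}`, uniformly. -/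
theorem exists_norm_opBlk_inverse_le (hK : 0 ≤ K) (hlam : 0 < lam) (hκ : 3 < κ) :
    ∃ c : ℝ, 0 ≤ c ∧ ∀ (V : Type) [NormedAddCommGroup V] [InnerProductSpace ℝ V]
      (A E : SeqL2 V →L[ℝ] SeqL2 V),
      (∀ s s' : ℤ, ‖opBlk A s s'‖ ≤ K * gu ((s : ℝ) - s') ^ (-κ)) →
      (∀ y : SeqL2 V, lam * ‖y‖ ^ 2 ≤ inner ℝ y (A y)) →
      A.comp E = ContinuousLinearMap.id ℝ _ →
      ∀ s s' : ℤ, ‖opBlk E s s'‖ ≤ c * gu ((s : ℝ) - s') ^ (-(κ - 1)) := by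
  obtain ⟨C, hC, h⟩ := inverseColumnBound hK hlam hκ
  refine ⟨√C, Real.sqrt_nonneg C, fun V _ _ A E hA hco hAE s τ => ?_⟩
  have hg := gu_rpow_pos ((s : ℝ) - τ) (κ - 1)
  refine ContinuousLinearMap.opNorm_le_bound _
    (mul_nonneg (Real.sqrt_nonneg C) (gu_rpow_pos _ _).le) fun e => ?_
  have h1 := h V A (E (lp.single 2 τ e)) τ e ⟨hA, hco, DFunLike.congr_fun hAE _⟩ {s}
  rw [Finset.sum_singleton] at h1
  have h2 := Real.le_sqrt_of_sq_le h1
  rw [Real.sqrt_mul hC, Real.sqrt_sq (norm_nonneg e)] at h2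
  rw [Real.rpow_neg (gu_pos _).le, mul_right_comm, ← div_eq_mul_inv, le_div_iff₀ hg, mul_comm]
  exact h2

end InverseDecay

section Entries

theorem orthonormal_lp_single {ι : Type*} [DecidableEq ι] {α : Type*} [Fintype α]
    [DecidableEq α] :
    Orthonormal ℝ fun i : ι × α =>
      (lp.single 2 i.1 (EuclideanSpace.single i.2 1) : lp (fun _ : ι => EuclideanSpace ℝ α) 2) := by
  rw [orthonormal_iff_ite]
  rintro ⟨s, i⟩ ⟨s', j⟩
  refine (lp.inner_single_left (G := fun _ : ι => EuclideanSpace ℝ α) s _ _).trans ?_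
  by_cases h : s = s'
  · subst h
    rw [lp.single_apply_self (E := fun _ : ι => EuclideanSpace ℝ α)]
    simp [EuclideanSpace.inner_single_left, PiLp.single_apply]
  · rw [lp.single_apply_ne (E := fun _ : ι => EuclideanSpace ℝ α) 2 s' _ h]
    simp [h]

section Orthonormal

variable {ι H : Type*} [NormedAddCommGroup H] [InnerProductSpace ℝ H]

theorem Orthonormal.norm_sq_sum_smul {u : ι → H} (hu : Orthonormal ℝ u) (T : Finset ι)
    (a : ι → ℝ) : ‖∑ i ∈ T, a i • u i‖ ^ 2 = ∑ i ∈ T, a i ^ 2 := by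
  rw [← real_inner_self_eq_norm_sq, hu.inner_sum]
  simp [sq]

theorem inner_sum_smul_map_sum_smul {κ H' : Type*} [NormedAddCommGroup H']
    [InnerProductSpace ℝ H'] (u : ι → H) (v : κ → H') (A : H' →L[ℝ] H) (S : Finset ι)
    (T : Finset κ) (a : ι → ℝ) (b : κ → ℝ) :
    inner ℝ (∑ i ∈ S, a i • u i) (A (∑ j ∈ T, b j • v j)) =
      ∑ i ∈ S, ∑ j ∈ T, a i * (b j * inner ℝ (u i) (A (v j))) := by
  simp only [map_sum, map_smul, sum_inner, inner_sum, inner_smul_left, inner_smul_right,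
    Finset.mul_sum, conj_trivial]
  rw [Finset.sum_comm]
  exact Finset.sum_congr rfl fun i _ => Finset.sum_congr rfl fun j _ => by ring

end Orthonormal

theorem euclideanSpace_eq_sum {α : Type*} [Fintype α] [DecidableEq α] (x : EuclideanSpace ℝ α) :
    x = ∑ i, x i • EuclideanSpace.single i (1 : ℝ) := by
  simpa using ((EuclideanSpace.basisFun α ℝ).sum_repr x).symm

theorem Orthonormal.norm_sum_smul {γ H : Type*} [Fintype γ] [NormedAddCommGroup H]
    [InnerProductSpace ℝ H] {w : γ → H} (hw : Orthonormal ℝ w) (z : EuclideanSpace ℝ γ) :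
    ‖∑ i, z i • w i‖ = ‖z‖ := by
  rw [← sq_eq_sq₀ (norm_nonneg _) (norm_nonneg _), hw.norm_sq_sum_smul,
    EuclideanSpace.norm_sq_eq]
  simp

/-- An operator whose matrix is a compression of `A` along orthonormal families has norm at most
that of `A`. -/
theorem norm_le_of_entries {α β H H' : Type*} [Fintype α] [DecidableEq α] [Fintype β]
    [DecidableEq β] [NormedAddCommGroup H] [InnerProductSpace ℝ H] [NormedAddCommGroup H']
    [InnerProductSpace ℝ H'] {u : α → H} {v : β → H'} (hu : Orthonormal ℝ u)
    (hv : Orthonormal ℝ v) (A : H' →L[ℝ] H) (L : EuclideanSpace ℝ β →L[ℝ] EuclideanSpace ℝ α)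
    (h : ∀ i j, L (EuclideanSpace.single j 1) i = inner ℝ (u i) (A (v j))) : ‖L‖ ≤ ‖A‖ := by
  refine ContinuousLinearMap.opNorm_le_bound _ (norm_nonneg A) fun y => ?_
  have hin : inner ℝ (L y) (L y) = inner ℝ (∑ i, L y i • u i) (A (∑ j, y j • v j)) := by
    rw [inner_sum_smul_map_sum_smul]
    conv_lhs => rw [euclideanSpace_eq_sum (L y)]; arg 3; rw [← euclideanSpace_eq_sum (L y),
      euclideanSpace_eq_sum y]
    rw [inner_sum_smul_map_sum_smul]
    simp only [EuclideanSpace.inner_single_left, h, map_one, one_mul]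
  rcases (norm_nonneg (L y)).eq_or_lt with h0 | h0
  · rw [← h0]; positivity
  · refine le_of_mul_le_mul_left ?_ h0
    calc ‖L y‖ * ‖L y‖ = inner ℝ (L y) (L y) := by rw [real_inner_self_eq_norm_mul_norm]
      _ ≤ ‖∑ i, L y i • u i‖ * ‖A (∑ j, y j • v j)‖ := hin ▸ real_inner_le_norm _ _
      _ ≤ ‖L y‖ * (‖A‖ * ‖y‖) := by
        rw [hu.norm_sum_smul, ← hv.norm_sum_smul y]
        gcongr
        exact A.le_opNorm _

variable {p : ℕ} {α β : Type} [Fintype α] [DecidableEq α] [Fintype β] [DecidableEq β]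

theorem opBlk_single_apply (B : HE β →L[ℝ] HE α) (t τ : ℤ) (i : α) (j : β) :
    opBlk B t τ (EuclideanSpace.single j 1) i = entE B t τ i j := by
  refine Eq.symm ((lp.inner_single_left (G := fun _ : ℤ => EuclideanSpace ℝ α) t _ _).trans ?_)
  rw [EuclideanSpace.inner_single_left, map_one, one_mul]
  rfl

theorem inner_single_toEuclideanLin {m n : Type*} [Fintype m] [DecidableEq m] [Fintype n]
    [DecidableEq n] (M : Matrix m n ℝ) (i : m) (j : n) :
    inner ℝ (EuclideanSpace.single i (1 : ℝ))
      (Matrix.toEuclideanLin M (EuclideanSpace.single j 1)) = M i j := by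
  simp [EuclideanSpace.inner_single_left, Matrix.toEuclideanLin, Matrix.toLpLin_apply]

theorem orthonormal_euclideanSpace_single {γ : Type*} [Fintype γ] [DecidableEq γ] :
    Orthonormal ℝ fun i : γ => EuclideanSpace.single i (1 : ℝ) := by
  rw [orthonormal_iff_ite]
  intro i j
  simp [EuclideanSpace.inner_single_left, PiLp.single_apply]

theorem norm_opBlk_le_specNorm {f : α → Fin p} {g : β → Fin p} (hf : f.Injective)
    (hg : g.Injective) (B : HE β →L[ℝ] HE α) (t τ : ℤ) (M : Matrix (Fin p) (Fin p) ℝ)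
    (h : ∀ i j, entE B t τ i j = M (f i) (g j)) : ‖opBlk B t τ‖ ≤ specNorm M := by
  have hb : Orthonormal ℝ fun i : Fin p => EuclideanSpace.single i (1 : ℝ) :=
    orthonormal_euclideanSpace_single
  refine norm_le_of_entries (hb.comp f hf) (hb.comp g hg) _ _ fun i j => ?_
  rw [opBlk_single_apply, h]
  exact (inner_single_toEuclideanLin M _ _).symm

theorem specNorm_le_norm_opBlk (B : HE β →L[ℝ] HE α) (t τ : ℤ) (M : Matrix α β ℝ)
    (h : ∀ i j, M i j = entE B t τ i j) : specNorm M ≤ ‖opBlk B t τ‖ := by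
  refine norm_le_of_entries orthonormal_euclideanSpace_single
    orthonormal_euclideanSpace_single _ _ fun i j => ?_
  rw [EuclideanSpace.inner_single_left, map_one, one_mul, opBlk_single_apply, ← h,
    ← inner_single_toEuclideanLin M i j, EuclideanSpace.inner_single_left, map_one, one_mul]
  rfl

theorem entE_sub (B B' : HE β →L[ℝ] HE α) (t τ : ℤ) (i : α) (j : β) :
    entE (B - B') t τ i j = entE B t τ i j - entE B' t τ i j := by
  simp [entE, inner_sub_right]

theorem specNorm_schurBlock_sub_le (CSS TSS : HE (Fin 2) →L[ℝ] HE (Fin 2))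
    (X Y : HE β →L[ℝ] HE (Fin 2)) (E F : HE β →L[ℝ] HE β) (t τ : ℤ) :
    specNorm (schurBlock CSS X E t τ - schurBlock TSS Y F t τ) ≤
      ‖opBlk ((CSS - X.comp (E.comp (ContinuousLinearMap.adjoint X))) -
        (TSS - Y.comp (F.comp (ContinuousLinearMap.adjoint Y)))) t τ‖ :=
  specNorm_le_norm_opBlk _ t τ _ fun i j => (entE_sub _ _ t τ i j).symm

/-- Coercivity passes to entrywise limits of shifted compressions. -/
theorem coercive_of_tendsto {lam : ℝ} (A : HE β →L[ℝ] HE β) {f : β → Fin p} (hf : f.Injective)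
    (B : ℕ → Hp p →L[ℝ] Hp p) (r : ℕ → ℤ)
    (hB : ∀ n (v : Hp p), lam * ‖v‖ ^ 2 ≤ inner ℝ v (B n v))
    (hlim : ∀ (s s' : ℤ) (c c' : β), Filter.Tendsto
      (fun n => blk (B n) (r n + s) (r n + s') (f c) (f c')) Filter.atTop
      (nhds (entE A s s' c c'))) (v : HE β) :
    lam * ‖v‖ ^ 2 ≤ inner ℝ v (A v) := by
  have hu : Orthonormal ℝ fun i : ℤ × β => (bvE i.1 i.2 : HE β) := orthonormal_lp_single
  have hw : ∀ n, Orthonormal ℝ fun i : ℤ × β => bvec p (r n + i.1) (f i.2) := fun n =>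
    (orthonormal_lp_single (ι := ℤ) (α := Fin p)).comp
      (fun i : ℤ × β => (r n + i.1, f i.2)) fun i j hij => by
        simp only [Prod.mk.injEq, add_right_inj] at hij
        exact Prod.ext hij.1 (hf hij.2)
  have hfin : ∀ (T : Finset (ℤ × β)) (a : ℤ × β → ℝ),
      lam * ‖∑ i ∈ T, a i • (bvE i.1 i.2 : HE β)‖ ^ 2 ≤
        inner ℝ (∑ i ∈ T, a i • (bvE i.1 i.2 : HE β))
          (A (∑ i ∈ T, a i • (bvE i.1 i.2 : HE β))) := fun T a => by
    rw [hu.norm_sq_sum_smul, inner_sum_smul_map_sum_smul]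
    have ht : Filter.Tendsto (fun n => ∑ i ∈ T, ∑ j ∈ T, a i * (a j *
        blk (B n) (r n + i.1) (r n + j.1) (f i.2) (f j.2))) Filter.atTop
        (nhds (∑ i ∈ T, ∑ j ∈ T, a i * (a j * entE A i.1 j.1 i.2 j.2))) :=
      tendsto_finsetSum _ fun i _ => tendsto_finsetSum _ fun j _ =>
        ((hlim _ _ _ _).const_mul _).const_mul _
    refine ge_of_tendsto' ht fun n => ?_
    have h1 := hB n (∑ i ∈ T, a i • bvec p (r n + i.1) (f i.2))
    rwa [(hw n).norm_sq_sum_smul, inner_sum_smul_map_sum_smul] at h1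
  have hv : ∀ s, (lp.single 2 s (v s) : HE β) = ∑ c, v s c • (bvE s c : HE β) := fun s => by
    have h1 := congrArg (lp.singleContinuousLinearMap ℝ (fun _ : ℤ => EuclideanSpace ℝ β) 2 s)
      (euclideanSpace_eq_sum (v s))
    rw [map_sum] at h1
    simp only [map_smul] at h1
    exact h1
  have hsum : Filter.Tendsto (fun S : Finset ℤ =>
      ∑ i ∈ S ×ˢ Finset.univ, v i.1 i.2 • (bvE i.1 i.2 : HE β)) Filter.atTop (nhds v) := by
    have h1 : HasSum (fun s : ℤ => (lp.single 2 s (v s) : HE β)) v := lp.hasSum_single (by simp) v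
    simp only [hv] at h1
    simpa only [Finset.sum_product, HasSum, SummationFilter.unconditional_filter] using h1
  refine le_of_tendsto_of_tendsto' ((hsum.norm.pow 2).const_mul lam)
    (hsum.inner ((A.continuous.tendsto v).comp hsum)) fun S => ?_
  exact hfin _ fun i => v i.1 i.2

end Entries

section Schur

open ContinuousLinearMap (adjoint)

variable {V W : Type*} [NormedAddCommGroup V] [InnerProductSpace ℝ V] [CompleteSpace V]
  [NormedAddCommGroup W] [InnerProductSpace ℝ W] [CompleteSpace W]

/-- The constant in the perturbation bound for Schur complements. -/
def schurConst (α β k e : ℝ) : ℝ :=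
  1 + e * k * convConst α * convConst α +
    k * e * convConst α * convConst β * (e * k * convConst α) * convConst β +
    k * e * convConst α * convConst α

theorem schurConst_pos {α β k e : ℝ} (hk : 0 ≤ k) (he : 0 ≤ e) : 0 < schurConst α β k e := by
  have := convConst_nonneg α
  have := convConst_nonneg β
  unfold schurConst
  positivity

theorem gu_rpow_neg_mono (x : ℝ) {α β : ℝ} (h : β ≤ α) : gu x ^ (-α) ≤ gu x ^ (-β) :=
  Real.rpow_le_rpow_of_exponent_le (one_le_gu x) (neg_le_neg h)

theorem gu_rpow_sub_mul (x α β : ℝ) : gu x ^ (α - β) * gu x ^ (-α) = gu x ^ (-β) := by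
  rw [← Real.rpow_add (gu_pos x)]
  congr 1
  ring

/-- Perturbation bound for the `t`-th row of a Schur complement, when the perturbation of the
row `s` of each operator may grow like `⟨s - t⟩^{α - β}`. -/
theorem norm_opBlk_schur_sub_le {α β k e ε : ℝ} (hβ : 1 < β) (hβα : β ≤ α) (hk : 0 ≤ k)
    (he : 0 ≤ e) (hε : 0 ≤ ε) {S S' : SeqL2 W →L[ℝ] SeqL2 W} {X Y : SeqL2 V →L[ℝ] SeqL2 W}
    {A B E F : SeqL2 V →L[ℝ] SeqL2 V} (t τ : ℤ)
    (hX : ∀ s s' : ℤ, ‖opBlk X s s'‖ ≤ k * gu ((s : ℝ) - s') ^ (-α))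
    (hY : ∀ s s' : ℤ, ‖opBlk Y s s'‖ ≤ k * gu ((s : ℝ) - s') ^ (-α))
    (hE : ∀ s s' : ℤ, ‖opBlk E s s'‖ ≤ e * gu ((s : ℝ) - s') ^ (-α))
    (hF : ∀ s s' : ℤ, ‖opBlk F s s'‖ ≤ e * gu ((s : ℝ) - s') ^ (-α))
    (hAE : A.comp E = ContinuousLinearMap.id ℝ _) (hFB : F.comp B = ContinuousLinearMap.id ℝ _)
    (hS : ∀ s s' : ℤ, ‖opBlk (S - S') s s'‖ ≤
      ε * (gu ((s : ℝ) - t) ^ (α - β) * gu ((s : ℝ) - s') ^ (-α)))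
    (hXY : ∀ s s' : ℤ, ‖opBlk (X - Y) s s'‖ ≤
      ε * (gu ((s : ℝ) - t) ^ (α - β) * gu ((s : ℝ) - s') ^ (-α)))
    (hBA : ∀ s s' : ℤ, ‖opBlk (B - A) s s'‖ ≤
      ε * (gu ((s : ℝ) - t) ^ (α - β) * gu ((s : ℝ) - s') ^ (-α))) :
    ‖opBlk ((S - X.comp (E.comp (adjoint X))) - (S' - Y.comp (F.comp (adjoint Y)))) t τ‖ ≤
      schurConst α β k e * ε * gu ((t : ℝ) - τ) ^ (-β) := by
  have hα : 1 < α := hβ.trans_le hβα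
  have hq := convConst_nonneg α
  have hq' := convConst_nonneg β
  have hdecomp : (S - X.comp (E.comp (adjoint X))) - (S' - Y.comp (F.comp (adjoint Y))) =
      S - S' - (X - Y).comp (E.comp (adjoint X)) -
        ((Y.comp F).comp (B - A)).comp (E.comp (adjoint X)) -
        (Y.comp F).comp (adjoint (X - Y)) := by
    have h1 : ∀ y, A (E y) = y := DFunLike.congr_fun hAE
    have h2 : ∀ y, F (B y) = y := DFunLike.congr_fun hFB
    refine ContinuousLinearMap.ext fun x => ?_
    simp only [map_sub, sub_apply, ContinuousLinearMap.comp_apply, h1, h2]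
    abel
  have hrow : ∀ s', ‖opBlk (X - Y) t s'‖ ≤ ε * gu ((t : ℝ) - s') ^ (-α) := fun s' => by
    simpa [gu_zero] using hXY t s'
  have hX' : ∀ s s' : ℤ, ‖opBlk (adjoint X) s s'‖ ≤ k * gu ((s : ℝ) - s') ^ (-α) := fun s s' => by
    rw [norm_opBlk_adjoint, gu_sub_comm]
    exact hX s' s
  have hEX : ∀ s s' : ℤ, ‖opBlk (E.comp (adjoint X)) s s'‖ ≤
      e * k * convConst α * gu ((s : ℝ) - s') ^ (-α) := fun s s' =>
    norm_opBlk_comp_le_of_le _ _ hα he hk s s' (hE s) fun r => hX' r s'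
  have hYF : ∀ s s' : ℤ, ‖opBlk (Y.comp F) s s'‖ ≤
      k * e * convConst α * gu ((s : ℝ) - s') ^ (-α) := fun s s' =>
    norm_opBlk_comp_le_of_le _ _ hα hk he s s' (hY s) fun r => hF r s'
  have hmono : ∀ (c : ℝ) (x : ℝ), 0 ≤ c → c * gu x ^ (-α) ≤ c * gu x ^ (-β) := fun c x hc =>
    mul_le_mul_of_nonneg_left (gu_rpow_neg_mono x hβα) hc
  have h0 : ‖opBlk (S - S') t τ‖ ≤ ε * gu ((t : ℝ) - τ) ^ (-β) :=
    (show _ ≤ ε * gu ((t : ℝ) - τ) ^ (-α) by simpa [gu_zero] using hS t τ).trans (hmono _ _ hε)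
  have h1 : ‖opBlk ((X - Y).comp (E.comp (adjoint X))) t τ‖ ≤
      ε * (e * k * convConst α) * convConst α * gu ((t : ℝ) - τ) ^ (-β) :=
    (norm_opBlk_comp_le_of_le _ _ hα hε (by positivity) t τ hrow fun r => hEX r τ).trans
      (hmono _ _ (by positivity))
  have h2 : ∀ s : ℤ, ‖opBlk ((Y.comp F).comp (B - A)) t s‖ ≤
      k * e * convConst α * ε * convConst β * gu ((t : ℝ) - s) ^ (-β) := fun s => by
    refine norm_opBlk_comp_le_conv _ _ hβ (by positivity) t s fun r => ?_
    calc ‖opBlk (Y.comp F) t r‖ * ‖opBlk (B - A) r s‖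
        ≤ k * e * convConst α * gu ((t : ℝ) - r) ^ (-α) *
          (ε * (gu ((t : ℝ) - r) ^ (α - β) * gu ((r : ℝ) - s) ^ (-α))) := by
          refine mul_le_mul (hYF t r) ?_ (norm_nonneg _)
            (mul_nonneg (by positivity) (gu_rpow_pos _ _).le)
          rw [gu_sub_comm (t : ℝ) r]
          exact hBA r s
      _ = k * e * convConst α * ε *
          (gu ((t : ℝ) - r) ^ (α - β) * gu ((t : ℝ) - r) ^ (-α) * gu ((r : ℝ) - s) ^ (-α)) := by
          ring
      _ ≤ k * e * convConst α * ε * (gu ((t : ℝ) - r) ^ (-β) * gu ((r : ℝ) - s) ^ (-β)) := by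
          rw [gu_rpow_sub_mul]
          exact mul_le_mul_of_nonneg_left (mul_le_mul_of_nonneg_left
            (gu_rpow_neg_mono _ hβα) (gu_rpow_pos _ _).le) (by positivity)
  have h3 : ‖opBlk (((Y.comp F).comp (B - A)).comp (E.comp (adjoint X))) t τ‖ ≤
      k * e * convConst α * ε * convConst β * (e * k * convConst α) * convConst β *
        gu ((t : ℝ) - τ) ^ (-β) :=
    norm_opBlk_comp_le_of_le _ _ hβ (by positivity) (by positivity) t τ h2 fun r =>
      (hEX r τ).trans (hmono _ _ (by positivity))
  have h4 : ‖opBlk ((Y.comp F).comp (adjoint (X - Y))) t τ‖ ≤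
      k * e * convConst α * ε * convConst α * gu ((t : ℝ) - τ) ^ (-β) := by
    have hg := (gu_rpow_pos ((τ : ℝ) - t) (α - β)).le
    refine (norm_opBlk_comp_le_of_le _ _ hα (by positivity)
      (mul_nonneg hε hg) t τ (hYF t) fun r => ?_).trans_eq ?_
    · rw [norm_opBlk_adjoint, gu_sub_comm (r : ℝ), mul_assoc]
      exact hXY τ r
    · rw [← gu_rpow_sub_mul _ α β, gu_sub_comm (τ : ℝ)]
      ring
  rw [hdecomp, opBlk_sub, opBlk_sub, opBlk_sub]
  refine (norm_sub_le_of_le (norm_sub_le_of_le (norm_sub_le_of_le h0 h1) h3) h4).trans_eq ?_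
  unfold schurConst
  ring

end Schur

section SpecNorm

variable {m n : Type*} [Fintype m] [Fintype n] [DecidableEq n]

theorem specNorm_nonneg (M : Matrix m n ℝ) : 0 ≤ specNorm M := norm_nonneg _

theorem specNorm_sub_le (M M' : Matrix m n ℝ) : specNorm (M - M') ≤ specNorm M + specNorm M' := by
  unfold specNorm
  rw [map_sub, map_sub]
  exact norm_sub_le _ _

theorem specNorm_sub_le_add (M M' M'' : Matrix m n ℝ) :
    specNorm (M - M'') ≤ specNorm (M - M') + specNorm (M' - M'') := by
  unfold specNorm
  simp only [map_sub]
  exact norm_sub_le_norm_sub_add_norm_sub _ _ _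

theorem abs_apply_le_specNorm [DecidableEq m] (M : Matrix m n ℝ) (i : m) (j : n) :
    |M i j| ≤ specNorm M := by
  rw [← inner_single_toEuclideanLin M i j]
  refine (abs_real_inner_le_norm _ _).trans ?_
  simpa [specNorm] using (LinearMap.toContinuousLinearMap (Matrix.toEuclideanLin M)).le_opNorm
    (EuclideanSpace.single j 1)

end SpecNorm

theorem specNorm_schurBlock_sub_le_of_entries {p : ℕ} {β : Type} [Fintype β] [DecidableEq β]
    {f : Fin 2 → Fin p} {g : β → Fin p} (hf : f.Injective) (hg : g.Injective)
    {α γ k e ε : ℝ} (hγ : 1 < γ) (hγα : γ ≤ α) (hk : 0 ≤ k) (he : 0 ≤ e) (hε : 0 ≤ ε)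
    {M M' : ℤ → ℤ → Matrix (Fin p) (Fin p) ℝ}
    {S S' : HE (Fin 2) →L[ℝ] HE (Fin 2)} {X Y : HE β →L[ℝ] HE (Fin 2)}
    {A B E F : HE β →L[ℝ] HE β} (t τ : ℤ)
    (hS : ∀ s s' i j, entE S s s' i j = M s s' (f i) (f j))
    (hX : ∀ s s' i c, entE X s s' i c = M s s' (f i) (g c))
    (hA : ∀ s s' c c', entE A s s' c c' = M s s' (g c) (g c'))
    (hS' : ∀ s s' i j, entE S' s s' i j = M' s s' (f i) (f j))
    (hY : ∀ s s' i c, entE Y s s' i c = M' s s' (f i) (g c))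
    (hB : ∀ s s' c c', entE B s s' c c' = M' s s' (g c) (g c'))
    (hAE : A.comp E = ContinuousLinearMap.id ℝ _) (hFB : F.comp B = ContinuousLinearMap.id ℝ _)
    (hE : ∀ s s' : ℤ, ‖opBlk E s s'‖ ≤ e * gu ((s : ℝ) - s') ^ (-α))
    (hF : ∀ s s' : ℤ, ‖opBlk F s s'‖ ≤ e * gu ((s : ℝ) - s') ^ (-α))
    (hM : ∀ s s' : ℤ, specNorm (M s s') ≤ k * gu ((s : ℝ) - s') ^ (-α))
    (hM' : ∀ s s' : ℤ, specNorm (M' s s') ≤ k * gu ((s : ℝ) - s') ^ (-α))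
    (hMM' : ∀ s s' : ℤ, specNorm (M s s' - M' s s') ≤
      ε * (gu ((s : ℝ) - t) ^ (α - γ) * gu ((s : ℝ) - s') ^ (-α))) :
    specNorm (schurBlock S X E t τ - schurBlock S' Y F t τ) ≤
      schurConst α γ k e * ε * gu ((t : ℝ) - τ) ^ (-γ) := by
  have hsub : ∀ {α₁ α₂ : Type} [Fintype α₁] [DecidableEq α₁] [Fintype α₂] [DecidableEq α₂]
      {f₁ : α₁ → Fin p} {f₂ : α₂ → Fin p}, f₁.Injective → f₂.Injective →
      ∀ {Z Z' : HE α₂ →L[ℝ] HE α₁}, (∀ s s' i j, entE Z s s' i j = M s s' (f₁ i) (f₂ j)) →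
      (∀ s s' i j, entE Z' s s' i j = M' s s' (f₁ i) (f₂ j)) → ∀ s s' : ℤ,
      ‖opBlk (Z - Z') s s'‖ ≤
        ε * (gu ((s : ℝ) - t) ^ (α - γ) * gu ((s : ℝ) - s') ^ (-α)) := by
    intro _ _ _ _ _ _ _ _ h₁ h₂ _ _ hZ hZ' s s'
    refine (norm_opBlk_le_specNorm h₁ h₂ _ s s' (M s s' - M' s s') fun i j => ?_).trans
      (hMM' s s')
    rw [entE_sub, hZ, hZ', Matrix.sub_apply]
  refine (specNorm_schurBlock_sub_le S S' X Y E F t τ).trans ?_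
  refine norm_opBlk_schur_sub_le hγ hγα hk he hε t τ
    (fun s s' => (norm_opBlk_le_specNorm hf hg _ s s' _ (hX s s')).trans (hM s s'))
    (fun s s' => (norm_opBlk_le_specNorm hf hg _ s s' _ (hY s s')).trans (hM' s s'))
    hE hF hAE hFB (hsub hf hf hS hS') (hsub hf hg hX hY) fun s s' => ?_
  rw [opBlk_sub, norm_sub_rev, ← opBlk_sub]
  exact hsub hg hg hA hB s s'

theorem gu_rpow_le_one (x : ℝ) {α : ℝ} (hα : α ≤ 0) : gu x ^ α ≤ 1 :=
  Real.rpow_le_one_of_one_le_of_nonpos (one_le_gu x) hα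

namespace AssumptionLS

variable {p : ℕ} {K κ lamInf lamSup : ℝ} {N₀ : ℕ} {C : ℕ → Hp p →L[ℝ] Hp p}
  {Cr : ℤ → ℝ → Matrix (Fin p) (Fin p) ℝ}

theorem K_nonneg (h : AssumptionLS p K κ lamInf lamSup N₀ C Cr) : 0 ≤ K :=
  nonneg_of_mul_nonneg_left ((specNorm_nonneg _).trans (h.crBound 0 0)) (gu_rpow_pos _ _)

theorem specNorm_toeplitz_le (h : AssumptionLS p K κ lamInf lamSup N₀ C Cr) (u : ℝ) (s s' : ℤ) :
    specNorm (Cr (s - s') u) ≤ K * gu ((s : ℝ) - s') ^ (-κ) := by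
  simpa using h.crBound (s - s') u

theorem specNorm_toeplitz_sub_le (h : AssumptionLS p K κ lamInf lamSup N₀ C Cr) (u v : ℝ)
    (s s' : ℤ) :
    specNorm (Cr (s - s') u - Cr (s - s') v) ≤ K * |u - v| * gu ((s : ℝ) - s') ^ (-κ) := by
  simpa using h.crLip (s - s') u v

theorem specNorm_blk_sub_toeplitz_le (h : AssumptionLS p K κ lamInf lamSup N₀ C Cr) {N : ℕ}
    (hN : 1 ≤ N) (s s' : ℤ) (u : ℝ) :
    specNorm (blk (C N) s s' - Cr (s - s') u) ≤
      K * (1 / N + |(s : ℝ) / N - u|) * gu ((s : ℝ) - s') ^ (-(κ - 1)) := by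
  have hK := h.K_nonneg
  have hg := (gu_rpow_pos ((s : ℝ) - s') (-(κ - 1))).le
  have h1 : specNorm (blk (C N) s s' - Cr (s - s') ((s : ℝ) / N)) ≤
      K * (1 / N) * gu ((s : ℝ) - s') ^ (-(κ - 1)) := by
    refine (h.approx N hN s s').trans ?_
    rw [mul_right_comm, show -κ + 1 = -(κ - 1) by ring]
    gcongr
    exact min_le_left _ _
  have h2 : specNorm (Cr (s - s') ((s : ℝ) / N) - Cr (s - s') u) ≤
      K * |(s : ℝ) / N - u| * gu ((s : ℝ) - s') ^ (-(κ - 1)) :=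
    (h.specNorm_toeplitz_sub_le _ _ s s').trans
      (mul_le_mul_of_nonneg_left (gu_rpow_neg_mono _ (by linarith)) (by positivity))
  refine (specNorm_sub_le_add _ _ _).trans ((add_le_add h1 h2).trans_eq ?_)
  ring

theorem specNorm_blk_sub_toeplitz_div_le (h : AssumptionLS p K κ lamInf lamSup N₀ C Cr) {N : ℕ}
    (hN : 1 ≤ N) (s s' t : ℤ) :
    specNorm (blk (C N) s s' - Cr (s - s') ((t : ℝ) / N)) ≤
      2 * K * (1 / N) * (gu ((s : ℝ) - t) * gu ((s : ℝ) - s') ^ (-(κ - 1))) := by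
  have hK := h.K_nonneg
  have hg := (gu_rpow_pos ((s : ℝ) - s') (-(κ - 1))).le
  have hN0 : (0 : ℝ) < N := by exact_mod_cast hN
  calc specNorm (blk (C N) s s' - Cr (s - s') ((t : ℝ) / N))
      ≤ K * (1 / N + |(s : ℝ) / N - t / N|) * gu ((s : ℝ) - s') ^ (-(κ - 1)) :=
        h.specNorm_blk_sub_toeplitz_le hN s s' _
    _ = K * (1 / N) * (1 + |(s : ℝ) - t|) * gu ((s : ℝ) - s') ^ (-(κ - 1)) := by
        rw [← sub_div, abs_div, abs_of_pos hN0]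
        ring
    _ ≤ K * (1 / N) * (gu ((s : ℝ) - t) + gu ((s : ℝ) - t)) *
          gu ((s : ℝ) - s') ^ (-(κ - 1)) := by
        gcongr
        · exact one_le_gu _
        · exact abs_le_gu _
    _ = _ := by ring

theorem specNorm_blk_sub_toeplitz_le_two_mul (h : AssumptionLS p K κ lamInf lamSup N₀ C Cr)
    {N : ℕ} (hN : 1 ≤ N) (s s' : ℤ) (u : ℝ) :
    specNorm (blk (C N) s s' - Cr (s - s') u) ≤ 2 * K * gu ((s : ℝ) - s') ^ (-(κ - 1)) := by
  refine (specNorm_sub_le _ _).trans ((add_le_add (h.decay N hN s s')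
    (h.specNorm_toeplitz_le u s s')).trans ?_)
  rw [← two_mul, ← mul_assoc]
  exact mul_le_mul_of_nonneg_left (gu_rpow_neg_mono _ (by linarith))
    (mul_nonneg two_pos.le h.K_nonneg)

variable {β : Type} [Fintype β] [DecidableEq β] {g : β → Fin p}

theorem coercive_compression (h : AssumptionLS p K κ lamInf lamSup N₀ C Cr) (hg : g.Injective)
    {N : ℕ} (hN : N₀ ≤ N) {A : HE β →L[ℝ] HE β}
    (hA : ∀ s s' c c', entE A s s' c c' = blk (C N) s s' (g c) (g c')) (y : HE β) :
    lamInf * ‖y‖ ^ 2 ≤ inner ℝ y (A y) :=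
  coercive_of_tendsto A hg (fun _ => C N) (fun _ => 0) (fun _ => h.lower N hN)
    (fun s s' c c' => by simp [hA]) y

theorem coercive_toeplitz (h : AssumptionLS p K κ lamInf lamSup N₀ C Cr) (hκ : 1 ≤ κ)
    (hg : g.Injective) {u : ℝ} {A : HE β →L[ℝ] HE β}
    (hA : ∀ s s' c c', entE A s s' c c' = Cr (s - s') u (g c) (g c')) (y : HE β) :
    lamInf * ‖y‖ ^ 2 ≤ inner ℝ y (A y) := by
  have hK := h.K_nonneg
  refine coercive_of_tendsto A hg (fun n => C (n + (N₀ + 1)))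
    (fun n => ⌊u * (n + (N₀ + 1) : ℕ)⌋) (fun n => h.lower _ (by omega)) (fun s s' c c' => ?_) y
  rw [hA, tendsto_iff_norm_sub_tendsto_zero]
  have hlim : Filter.Tendsto (fun n : ℕ => K * (2 + |(s : ℝ)|) / ((n + (N₀ + 1) : ℕ) : ℝ))
      Filter.atTop (nhds 0) :=
    (tendsto_const_div_atTop_nhds_zero_nat _).comp (Filter.tendsto_add_atTop_nat _)
  refine squeeze_zero (fun _ => norm_nonneg _) (fun n => ?_) hlim
  set N := n + (N₀ + 1)
  have hN0 : (0 : ℝ) < N := by exact_mod_cast (by omega : 0 < n + (N₀ + 1))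
  set r := ⌊u * (N : ℝ)⌋
  have h1 := h.specNorm_blk_sub_toeplitz_le (N := N) (by omega) (r + s) (r + s') u
  rw [add_sub_add_left_eq_sub] at h1
  have h2 : |((r + s : ℤ) : ℝ) / N - u| ≤ (1 + |(s : ℝ)|) / N := by
    rw [div_sub' hN0.ne', abs_div, abs_of_pos hN0]
    gcongr
    have h3 : |(r : ℝ) - u * N| ≤ 1 :=
      abs_le.2 ⟨by linarith [Int.lt_floor_add_one (u * (N : ℝ))],
        by linarith [Int.floor_le (u * (N : ℝ))]⟩
    calc |((r + s : ℤ) : ℝ) - N * u| = |((r : ℝ) - u * N) + s| := by push_cast; congr 1; ring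
      _ ≤ 1 + |(s : ℝ)| := (abs_add_le _ _).trans (by gcongr)
  calc ‖blk (C N) (r + s) (r + s') (g c) (g c') - Cr (s - s') u (g c) (g c')‖
      ≤ specNorm (blk (C N) (r + s) (r + s') - Cr (s - s') u) :=
        abs_apply_le_specNorm (blk (C N) (r + s) (r + s') - Cr (s - s') u) _ _
    _ ≤ K * (1 / N + (1 + |(s : ℝ)|) / N) * 1 := by
        have h4 := gu_rpow_le_one (((r + s : ℤ) : ℝ) - ((r + s' : ℤ) : ℝ)) (α := -(κ - 1))
          (by linarith)
        refine h1.trans (mul_le_mul ?_ h4 (gu_rpow_pos _ _).le (by positivity))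
        gcongr
    _ = K * (2 + |(s : ℝ)|) / N := by ring

end AssumptionLS

/-- Theorem 3.7, bounds (3.10) and (3.11): smoothness of the pairwise partial covariance
`Δ^{−{a,b}}`.  Sub-operators are characterised by their scalar entries taken from
`𝐂^(N)` (resp. from the Toeplitz family `C_r(u)`), and `E` denotes the inverse of the
compression `𝐂_{S′,S′}`. -/
theorem pairwise_partial_covariance_smooth (K κ lamInf lamSup : ℝ) (N₀ : ℕ)
    (hκ : 3 < κ) (hInf : 0 < lamInf) (hle : lamInf ≤ lamSup) :
    ∃ 𝒦 : ℝ, 0 < 𝒦 ∧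
      ∀ (p : ℕ), 3 ≤ p →
        ∀ (C : ℕ → Hp p →L[ℝ] Hp p) (Cr : ℤ → ℝ → Matrix (Fin p) (Fin p) ℝ),
          AssumptionLS p K κ lamInf lamSup N₀ C Cr →
          ∀ a b : Fin p, a ≠ b →
            ∀ N : ℕ, N₀ ≤ N → 1 ≤ N →
              ∀ (CSS : HE (Fin 2) →L[ℝ] HE (Fin 2))
                (CSSp : HE {c : Fin p // c ≠ a ∧ c ≠ b} →L[ℝ] HE (Fin 2))
                (CSpSp E : HE {c : Fin p // c ≠ a ∧ c ≠ b} →L[ℝ]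
                  HE {c : Fin p // c ≠ a ∧ c ≠ b}),
                (∀ (t τ : ℤ) (i j : Fin 2),
                  entE CSS t τ i j = blk (C N) t τ (![a, b] i) (![a, b] j)) →
                (∀ (t τ : ℤ) (i : Fin 2) (c : {c : Fin p // c ≠ a ∧ c ≠ b}),
                  entE CSSp t τ i c = blk (C N) t τ (![a, b] i) (c : Fin p)) →
                (∀ (t τ : ℤ) (c c' : {c : Fin p // c ≠ a ∧ c ≠ b}),
                  entE CSpSp t τ c c' = blk (C N) t τ (c : Fin p) (c' : Fin p)) →
                CSpSp.comp E = ContinuousLinearMap.id ℝ _ →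
                E.comp CSpSp = ContinuousLinearMap.id ℝ _ →
                -- (3.10): local approximation at `u = t/N`
                (∀ (t τ : ℤ)
                  (TSS : HE (Fin 2) →L[ℝ] HE (Fin 2))
                  (TSSp : HE {c : Fin p // c ≠ a ∧ c ≠ b} →L[ℝ] HE (Fin 2))
                  (TSpSp F : HE {c : Fin p // c ≠ a ∧ c ≠ b} →L[ℝ]
                    HE {c : Fin p // c ≠ a ∧ c ≠ b}),
                  (∀ (s₁ s₂ : ℤ) (i j : Fin 2),
                    entE TSS s₁ s₂ i j =
                      Cr (s₁ - s₂) ((t : ℝ) / (N : ℝ)) (![a, b] i) (![a, b] j)) →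
                  (∀ (s₁ s₂ : ℤ) (i : Fin 2) (c : {c : Fin p // c ≠ a ∧ c ≠ b}),
                    entE TSSp s₁ s₂ i c =
                      Cr (s₁ - s₂) ((t : ℝ) / (N : ℝ)) (![a, b] i) (c : Fin p)) →
                  (∀ (s₁ s₂ : ℤ) (c c' : {c : Fin p // c ≠ a ∧ c ≠ b}),
                    entE TSpSp s₁ s₂ c c' =
                      Cr (s₁ - s₂) ((t : ℝ) / (N : ℝ)) (c : Fin p) (c' : Fin p)) →
                  TSpSp.comp F = ContinuousLinearMap.id ℝ _ →
                  F.comp TSpSp = ContinuousLinearMap.id ℝ _ →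
                  specNorm (schurBlock CSS CSSp E t τ - schurBlock TSS TSSp F t τ) ≤
                    𝒦 * zeta ((t : ℝ) - (τ : ℝ)) ^ (κ - 2) *
                      min (1 / (N : ℝ)) (zeta ((t : ℝ) - (τ : ℝ)))) ∧
                -- (3.11): Lipschitz continuity in `u`
                (∀ (u v : ℝ)
                  (USS : HE (Fin 2) →L[ℝ] HE (Fin 2))
                  (USSp : HE {c : Fin p // c ≠ a ∧ c ≠ b} →L[ℝ] HE (Fin 2))
                  (USpSp F : HE {c : Fin p // c ≠ a ∧ c ≠ b} →L[ℝ]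
                    HE {c : Fin p // c ≠ a ∧ c ≠ b})
                  (VSS : HE (Fin 2) →L[ℝ] HE (Fin 2))
                  (VSSp : HE {c : Fin p // c ≠ a ∧ c ≠ b} →L[ℝ] HE (Fin 2))
                  (VSpSp G : HE {c : Fin p // c ≠ a ∧ c ≠ b} →L[ℝ]
                    HE {c : Fin p // c ≠ a ∧ c ≠ b}),
                  (∀ (s₁ s₂ : ℤ) (i j : Fin 2),
                    entE USS s₁ s₂ i j = Cr (s₁ - s₂) u (![a, b] i) (![a, b] j)) →
                  (∀ (s₁ s₂ : ℤ) (i : Fin 2) (c : {c : Fin p // c ≠ a ∧ c ≠ b}),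
                    entE USSp s₁ s₂ i c = Cr (s₁ - s₂) u (![a, b] i) (c : Fin p)) →
                  (∀ (s₁ s₂ : ℤ) (c c' : {c : Fin p // c ≠ a ∧ c ≠ b}),
                    entE USpSp s₁ s₂ c c' = Cr (s₁ - s₂) u (c : Fin p) (c' : Fin p)) →
                  USpSp.comp F = ContinuousLinearMap.id ℝ _ →
                  F.comp USpSp = ContinuousLinearMap.id ℝ _ →
                  (∀ (s₁ s₂ : ℤ) (i j : Fin 2),
                    entE VSS s₁ s₂ i j = Cr (s₁ - s₂) v (![a, b] i) (![a, b] j)) →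
                  (∀ (s₁ s₂ : ℤ) (i : Fin 2) (c : {c : Fin p // c ≠ a ∧ c ≠ b}),
                    entE VSSp s₁ s₂ i c = Cr (s₁ - s₂) v (![a, b] i) (c : Fin p)) →
                  (∀ (s₁ s₂ : ℤ) (c c' : {c : Fin p // c ≠ a ∧ c ≠ b}),
                    entE VSpSp s₁ s₂ c c' = Cr (s₁ - s₂) v (c : Fin p) (c' : Fin p)) →
                  VSpSp.comp G = ContinuousLinearMap.id ℝ _ →
                  G.comp VSpSp = ContinuousLinearMap.id ℝ _ →
                  ∀ t τ : ℤ,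
                    specNorm (schurBlock USS USSp F t τ - schurBlock VSS VSSp G t τ) ≤
                      𝒦 * |u - v| * zeta ((t : ℝ) - (τ : ℝ)) ^ (κ - 1)) := by
  rcases lt_or_ge K 0 with hK | hK
  · exact ⟨1, one_pos, fun p _ C Cr h => absurd h.K_nonneg hK.not_ge⟩
  obtain ⟨e, he, hinv⟩ := exists_norm_opBlk_inverse_le hK hInf hκ
  have hD₁ := schurConst_pos (α := κ - 1) (β := κ - 2) hK he
  have hD₂ := schurConst_pos (α := κ - 1) (β := κ - 1) hK he
  set D₁ := schurConst (κ - 1) (κ - 2) K e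
  set D₂ := schurConst (κ - 1) (κ - 1) K e
  refine ⟨(D₁ + D₂) * (2 * K) + 1, by positivity, ?_⟩
  intro p _ C Cr h a b hab N hN hN1 CSS CSSp CSpSp E hCSS hCSSp hCSpSp hCE _
  have hf : (![a, b] : Fin 2 → Fin p).Injective := List.nodup_ofFn.1 (by simpa using hab)
  have hg : (Subtype.val : {c : Fin p // c ≠ a ∧ c ≠ b} → Fin p).Injective :=
    Subtype.val_injective
  have hmono : ∀ s s' : ℤ, K * gu ((s : ℝ) - s') ^ (-κ) ≤ K * gu ((s : ℝ) - s') ^ (-(κ - 1)) :=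
    fun s s' => mul_le_mul_of_nonneg_left (gu_rpow_neg_mono _ (by linarith)) hK
  have hCr : ∀ (u : ℝ) (s s' : ℤ),
      specNorm (Cr (s - s') u) ≤ K * gu ((s : ℝ) - s') ^ (-(κ - 1)) := fun u s s' =>
    (h.specNorm_toeplitz_le u s s').trans (hmono s s')
  have htoep : ∀ {u : ℝ} {T F : HE {c : Fin p // c ≠ a ∧ c ≠ b} →L[ℝ]
      HE {c : Fin p // c ≠ a ∧ c ≠ b}},
      (∀ (s s' : ℤ) (c c' : {c : Fin p // c ≠ a ∧ c ≠ b}),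
        entE T s s' c c' = Cr (s - s') u c c') →
      T.comp F = ContinuousLinearMap.id ℝ _ →
      ∀ s s' : ℤ, ‖opBlk F s s'‖ ≤ e * gu ((s : ℝ) - s') ^ (-(κ - 1)) := fun hT hTF =>
    hinv _ _ _ (fun s s' => (norm_opBlk_le_specNorm hg hg _ s s' _ (hT s s')).trans
      (h.specNorm_toeplitz_le _ s s')) (h.coercive_toeplitz (by linarith) hg hT) hTF
  have hE : ∀ s s' : ℤ, ‖opBlk E s s'‖ ≤ e * gu ((s : ℝ) - s') ^ (-(κ - 1)) :=
    hinv _ _ _ (fun s s' => (norm_opBlk_le_specNorm hg hg _ s s' _ (hCSpSp s s')).trans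
      (h.decay N hN1 s s')) (h.coercive_compression hg hN hCSpSp) hCE
  refine ⟨fun t τ TSS TSSp TSpSp F hTSS hTSSp hTSpSp hTF hFT => ?_,
    fun u v USS USSp USpSp F VSS VSSp VSpSp G hUSS hUSSp hUSpSp hUF _ hVSS hVSSp hVSpSp hVG hGV
      t τ => ?_⟩
  · have hbound : ∀ {γ ε : ℝ}, 1 < γ → γ ≤ κ - 1 → 0 ≤ ε →
        (∀ s s' : ℤ, specNorm (blk (C N) s s' - Cr (s - s') ((t : ℝ) / N)) ≤
          ε * (gu ((s : ℝ) - t) ^ (κ - 1 - γ) * gu ((s : ℝ) - s') ^ (-(κ - 1)))) →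
        specNorm (schurBlock CSS CSSp E t τ - schurBlock TSS TSSp F t τ) ≤
          schurConst (κ - 1) γ K e * ε * gu ((t : ℝ) - τ) ^ (-γ) := fun h₁ h₂ hε hdiff =>
      specNorm_schurBlock_sub_le_of_entries hf hg h₁ h₂ hK he hε t τ hCSS hCSSp hCSpSp hTSS hTSSp
        hTSpSp hCE hFT hE (htoep hTSpSp hTF)
        (fun s s' => (h.decay N hN1 s s').trans (hmono s s')) (hCr _) hdiff
    have hfine := hbound (γ := κ - 2) (ε := 2 * K * (1 / N)) (by linarith) (by linarith)
      (by positivity) fun s s' => by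
        rw [show κ - 1 - (κ - 2) = 1 by ring, Real.rpow_one]
        exact h.specNorm_blk_sub_toeplitz_div_le hN1 s s' t
    have hcrude := hbound (γ := κ - 1) (ε := 2 * K) (by linarith) le_rfl (by positivity)
      fun s s' => by
        rw [sub_self, Real.rpow_zero, one_mul]
        exact h.specNorm_blk_sub_toeplitz_le_two_mul hN1 s s' _
    have hz := zeta_pos ((t : ℝ) - τ)
    have hz' := Real.rpow_pos_of_pos hz (κ - 2)
    rw [mul_min_of_nonneg _ _ (by positivity)]
    refine le_min (hfine.trans ?_) (hcrude.trans ?_)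
    · calc D₁ * (2 * K * (1 / N)) * gu ((t : ℝ) - τ) ^ (-(κ - 2))
          ≤ D₁ * (2 * K * (1 / N)) * zeta ((t : ℝ) - τ) ^ (κ - 2) := by
            gcongr
            exact gu_rpow_neg_le_zeta_rpow _ (by linarith)
        _ = D₁ * (2 * K) * zeta ((t : ℝ) - τ) ^ (κ - 2) * (1 / N) := by ring
        _ ≤ _ := by
            gcongr
            nlinarith [mul_nonneg hD₂.le hK]
    · calc D₂ * (2 * K) * gu ((t : ℝ) - τ) ^ (-(κ - 1))
          ≤ D₂ * (2 * K) * zeta ((t : ℝ) - τ) ^ (κ - 1) := by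
            gcongr
            exact gu_rpow_neg_le_zeta_rpow _ (by linarith)
        _ = D₂ * (2 * K) * zeta ((t : ℝ) - τ) ^ (κ - 2) * zeta ((t : ℝ) - τ) := by
            rw [show κ - 1 = κ - 2 + 1 by ring, Real.rpow_add_one hz.ne', mul_assoc _ _ (zeta _)]
        _ ≤ _ := by
            gcongr
            nlinarith [mul_nonneg hD₁.le hK]
  · have hlip := specNorm_schurBlock_sub_le_of_entries hf hg (γ := κ - 1) (ε := K * |u - v|)
      (by linarith) le_rfl hK he (by positivity) t τ hUSS hUSSp hUSpSp hVSS hVSSp hVSpSp hUF hGV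
      (htoep hUSpSp hUF) (htoep hVSpSp hVG) (hCr u) (hCr v) fun s s' => by
        rw [sub_self, Real.rpow_zero, one_mul]
        exact (h.specNorm_toeplitz_sub_le u v s s').trans
          (mul_le_mul_of_nonneg_left (gu_rpow_neg_mono _ (by linarith)) (by positivity))
    have hz' := Real.rpow_pos_of_pos (zeta_pos ((t : ℝ) - τ)) (κ - 1)
    refine hlip.trans ?_
    calc D₂ * (K * |u - v|) * gu ((t : ℝ) - τ) ^ (-(κ - 1))
        ≤ D₂ * (K * |u - v|) * zeta ((t : ℝ) - τ) ^ (κ - 1) := by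
          gcongr
          exact gu_rpow_neg_le_zeta_rpow _ (by linarith)
      _ = D₂ * K * |u - v| * zeta ((t : ℝ) - τ) ^ (κ - 1) := by ring
      _ ≤ _ := by
          gcongr
          nlinarith [mul_nonneg hD₁.le hK, mul_nonneg hD₂.le hK]
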